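/- Let β⃗ be sub-critical. There exist constants c, δ, α > 0 such that for all sufficiently large n and every integer t ≥ cn²: under the grand coupling, 𝔼[d_H(Z^+(t), Z^−(t))] ≤ (1 − δ/M)^{t − cn²} · M + e^{−αn}, where Z^+ and Z^− are the Glauber chains started from the full and the empty configuration; consequently, for any two initial probability distributions μ, ν on 𝒢_n, d_TV(μ_t, ν_t) ≤ (1 − δ/M)^{t − cn²} · M + e^{−αn}, where μ_t denotes the law of the Glauber chain at time t started from μ. -/

import Mathlib

open Finset MeasureTheory Filter
open scoped ENNReal NNReal

namespace ERGM

/-- The set of edges of the complete graph on `Fin n`: non-diagonal unordered pairs. -/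
abbrev EdgeSet (n : ℕ) : Type := {p : Sym2 (Fin n) // ¬ p.IsDiag}

/-- A configuration (graph on `n` vertices): an assignment of `true/false` to each edge. -/
abbrev Config (n : ℕ) : Type := EdgeSet n → Bool

/-- The value of the configuration `x` on the (unordered) pair `{i,j}`; `false` for `i = j`. -/
noncomputable def edgeVal {n : ℕ} (x : Config n) (i j : Fin n) : Bool :=
  if h : (s(i, j) : Sym2 (Fin n)).IsDiag then false else x ⟨s(i, j), h⟩

/-- Real-valued indicator of presence of the edge `{i,j}` in `x`. -/
noncomputable def edgeInd {n : ℕ} (x : Config n) (i j : Fin n) : ℝ :=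
  if edgeVal x i j = true then 1 else 0

open scoped Classical in
/-- Subgraph counting number `N_G(x)`: the number of copies of `G` in `x` (times the
number of automorphisms), i.e. the sum over injective `ψ` of the product of edge
indicators (each edge indicator is idempotent, so counting ordered adjacent pairs
yields the same value as counting edges). -/
noncomputable def NG {n m : ℕ} (G : SimpleGraph (Fin m)) (x : Config n) : ℝ :=
  ∑ ψ : Fin m ↪ Fin n, ∏ a : Fin m, ∏ b : Fin m,
    if G.Adj a b then edgeInd x (ψ a) (ψ b) else 1

/-- The Hamiltonian `H(x) = Σ_i β_i N_{G_i}(x) / n^{|V_i|-2}`. -/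
noncomputable def Hamiltonian {n s : ℕ} (V : Fin s → ℕ)
    (G : ∀ i, SimpleGraph (Fin (V i))) (β : Fin s → ℝ) (x : Config n) : ℝ :=
  ∑ i, β i * NG (G i) x / (n : ℝ) ^ (V i - 2)

/-- The ERGM probability mass function `π(x) ∝ exp(H(x))`. -/
noncomputable def ergmProb {n s : ℕ} (V : Fin s → ℕ)
    (G : ∀ i, SimpleGraph (Fin (V i))) (β : Fin s → ℝ) (x : Config n) : ℝ :=
  Real.exp (Hamiltonian V G β x) / ∑ y : Config n, Real.exp (Hamiltonian V G β y)

/-- Expectation of `f` with respect to the mass function `w`. -/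
noncomputable def expect {n : ℕ} (w : Config n → ℝ) (f : Config n → ℝ) : ℝ :=
  ∑ x : Config n, w x * f x

open scoped Classical in
/-- Probability of the event `A` with respect to the mass function `w`. -/
noncomputable def prob {n : ℕ} (w : Config n → ℝ) (A : Config n → Prop) : ℝ :=
  ∑ x : Config n, if A x then w x else 0

/-- The number of edges `|E(G)|` of a finite graph. -/
noncomputable def numEdges {m : ℕ} (G : SimpleGraph (Fin m)) : ℕ := G.edgeSet.ncard

/-- `Ψ_β(p) = Σ_i 2 β_i |E_i| p^{|E_i|-1}`. -/
noncomputable def Psi {s : ℕ} (V : Fin s → ℕ) (G : ∀ i, SimpleGraph (Fin (V i)))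
    (β : Fin s → ℝ) (p : ℝ) : ℝ :=
  ∑ i, 2 * β i * (numEdges (G i) : ℝ) * p ^ (numEdges (G i) - 1)

/-- `Φ(u) = e^u / (1 + e^u)`. -/
noncomputable def Phi (u : ℝ) : ℝ := Real.exp u / (1 + Real.exp u)

/-- `φ_β(p) = Φ(Ψ_β(p))`. -/
noncomputable def phiFn {s : ℕ} (V : Fin s → ℕ) (G : ∀ i, SimpleGraph (Fin (V i)))
    (β : Fin s → ℝ) : ℝ → ℝ := fun p => Phi (Psi V G β p)

/-- `β` is sub-critical (high temperature) with fixed point `p`: `p` is the unique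
solution of `φ_β(p) = p` and it satisfies `φ_β'(p) < 1`. -/
def Subcritical {s : ℕ} (V : Fin s → ℕ) (G : ∀ i, SimpleGraph (Fin (V i)))
    (β : Fin s → ℝ) (p : ℝ) : Prop :=
  phiFn V G β p = p ∧ (∀ q : ℝ, phiFn V G β q = q → q = p) ∧
    deriv (phiFn V G β) p < 1

/-- The discrete derivative `∂_e H(x) = H(x_{e+}) - H(x_{e-})`. -/
noncomputable def dHam {n s : ℕ} (V : Fin s → ℕ) (G : ∀ i, SimpleGraph (Fin (V i)))
    (β : Fin s → ℝ) (e : EdgeSet n) (x : Config n) : ℝ :=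
  Hamiltonian V G β (Function.update x e true) - Hamiltonian V G β (Function.update x e false)

/-- Real-valued indicator `X_e` of presence of edge `e`. -/
noncomputable def edgeX {n : ℕ} (e : EdgeSet n) (x : Config n) : ℝ := if x e = true then 1 else 0

/-- Two edges of `K_n` share a vertex. -/
def ShareVertex {n : ℕ} (e f : EdgeSet n) : Prop := ∃ v : Fin n, v ∈ e.1 ∧ v ∈ f.1


instance (n : ℕ) : MeasurableSpace (EdgeSet n) := ⊤

open scoped Classical in
/-- One step of the grand coupling driven by the seed `ω = (I, U)`: the coordinate `I`
of `x` is set to `1` iff `U ≤ Φ(∂_I H(x))`. -/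
noncomputable def gcStep {n s : ℕ} (V : Fin s → ℕ) (G : ∀ i, SimpleGraph (Fin (V i)))
    (β : Fin s → ℝ) (ω : EdgeSet n × ℝ) (x : Config n) : Config n :=
  Function.update x ω.1 (if ω.2 ≤ Phi (dHam V G β ω.1 x) then true else false)

/-- `t` steps of the grand coupling driven by the seeds `ω : Fin t → EdgeSet n × ℝ`. -/
noncomputable def gcRun {n s : ℕ} (V : Fin s → ℕ) (G : ∀ i, SimpleGraph (Fin (V i)))
    (β : Fin s → ℝ) : (t : ℕ) → (Fin t → EdgeSet n × ℝ) → Config n → Config n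
  | 0, _, x => x
  | t + 1, ω, x =>
      gcStep V G β (ω (Fin.last t)) (gcRun V G β t (fun i => ω i.castSucc) x)

/-- The law of one seed of the grand coupling: a uniformly chosen edge `I` together
with an independent uniform variable `U` on `[0,1]`. -/
noncomputable def seed (n : ℕ) : Measure (EdgeSet n × ℝ) :=
  ((Fintype.card (EdgeSet n) : ℝ≥0∞)⁻¹ • (Measure.count : Measure (EdgeSet n))).prod
    (volume.restrict (Set.Ioc (0 : ℝ) 1))

/-- The law of `t` independent seeds of the grand coupling. -/
noncomputable def seeds (n t : ℕ) : Measure (Fin t → EdgeSet n × ℝ) :=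
  Measure.pi fun _ => seed n

/-- The total variation distance between two measures. -/
noncomputable def dTVmeas {α : Type*} [MeasurableSpace α] (μ ν : Measure α) : ℝ :=
  ⨆ A : Set α, |(μ A).toReal - (ν A).toReal|

/-- The law at time `t` of the Glauber dynamics started from the initial
distribution `μ`. -/
noncomputable def lawAt {n s : ℕ} (V : Fin s → ℕ) (G : ∀ i, SimpleGraph (Fin (V i)))
    (β : Fin s → ℝ) (t : ℕ) (μ : Measure (Config n)) : Measure (Config n) :=
  Measure.map (fun q : Config n × (Fin t → EdgeSet n × ℝ) => gcRun V G β t q.2 q.1)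
    (μ.prod (seeds n t))

/-- The presence of the unordered pair `q` in `x`; `false` on the diagonal. -/
noncomputable def pairVal {n : ℕ} (x : Config n) (q : Sym2 (Fin n)) : Bool :=
  if h : q.IsDiag then false else x ⟨q, h⟩

/-- The real-valued indicator of the unordered pair `q` in `x`. -/
noncomputable def ind {n : ℕ} (x : Config n) (q : Sym2 (Fin n)) : ℝ :=
  if pairVal x q = true then 1 else 0

lemma ind_nonneg {n : ℕ} (x : Config n) (q : Sym2 (Fin n)) : 0 ≤ ind x q := by
  unfold ind; split_ifs <;> norm_num

lemma ind_le_one {n : ℕ} (x : Config n) (q : Sym2 (Fin n)) : ind x q ≤ 1 := by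
  unfold ind; split_ifs <;> norm_num

lemma pairVal_coe {n : ℕ} (x : Config n) (e : EdgeSet n) : pairVal x e.1 = x e := by
  unfold pairVal; rw [dif_neg e.2]

lemma ind_coe {n : ℕ} (x : Config n) (e : EdgeSet n) :
    ind x e.1 = if x e = true then 1 else 0 := by
  unfold ind; rw [pairVal_coe]

lemma pairVal_mono {n : ℕ} {x y : Config n} (h : x ≤ y) (q : Sym2 (Fin n)) :
    pairVal x q ≤ pairVal y q := by
  unfold pairVal; split_ifs
  · exact le_rfl
  · exact h _

lemma ind_mono {n : ℕ} {x y : Config n} (h : x ≤ y) (q : Sym2 (Fin n)) :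
    ind x q ≤ ind y q := by
  have := pairVal_mono h q
  unfold ind
  split_ifs with h1 h2 <;> norm_num
  rw [h1] at this
  exact absurd (Bool.eq_true_of_true_le this) h2

lemma pairVal_update_of_ne {n : ℕ} (x : Config n) (e : EdgeSet n) (b : Bool)
    {q : Sym2 (Fin n)} (h : q ≠ e.1) : pairVal (Function.update x e b) q = pairVal x q := by
  unfold pairVal
  split_ifs with hq
  · rfl
  · rw [Function.update_of_ne]
    exact fun h' => h (congrArg Subtype.val h')

lemma ind_update_of_ne {n : ℕ} (x : Config n) (e : EdgeSet n) (b : Bool)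
    {q : Sym2 (Fin n)} (h : q ≠ e.1) : ind (Function.update x e b) q = ind x q := by
  unfold ind; rw [pairVal_update_of_ne x e b h]

lemma ind_update_self {n : ℕ} (x : Config n) (e : EdgeSet n) (b : Bool) :
    ind (Function.update x e b) e.1 = if b = true then 1 else 0 := by
  rw [ind_coe, Function.update_self]

/-- The indicator that the image under `ψ` of every pair in `A` is present in `x`. -/
noncomputable def copyProd {n m : ℕ} (x : Config n) (A : Finset (Sym2 (Fin m)))
    (ψ : Fin m ↪ Fin n) : ℝ := ∏ h ∈ A, ind x (h.map ψ)

lemma copyProd_nonneg {n m : ℕ} (x : Config n) (A : Finset (Sym2 (Fin m)))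
    (ψ : Fin m ↪ Fin n) : 0 ≤ copyProd x A ψ := prod_nonneg fun _ _ => ind_nonneg _ _

lemma copyProd_mono {n m : ℕ} {x y : Config n} (h : x ≤ y) (A : Finset (Sym2 (Fin m)))
    (ψ : Fin m ↪ Fin n) : copyProd x A ψ ≤ copyProd y A ψ :=
  prod_le_prod (fun _ _ => ind_nonneg _ _) fun _ _ => ind_mono h _

open scoped Classical in
/-- The edges of `G` as a finset of unordered pairs. -/
noncomputable def edgesOf {m : ℕ} (G : SimpleGraph (Fin m)) : Finset (Sym2 (Fin m)) :=
  G.edgeFinset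

lemma mem_edgesOf {m : ℕ} (G : SimpleGraph (Fin m)) (h : Sym2 (Fin m)) :
    h ∈ edgesOf G ↔ h ∈ G.edgeSet := by
  classical
  simp [edgesOf]

lemma not_isDiag_of_mem_edgesOf {m : ℕ} {G : SimpleGraph (Fin m)} {h : Sym2 (Fin m)}
    (hh : h ∈ edgesOf G) : ¬ h.IsDiag :=
  G.not_isDiag_of_mem_edgeSet ((mem_edgesOf G h).1 hh)

lemma card_edgesOf {m : ℕ} (G : SimpleGraph (Fin m)) : (edgesOf G).card = numEdges G := by
  classical
  rw [numEdges, Set.ncard_eq_toFinset_card', edgesOf]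
  rfl

lemma NG_eq_sum_copyProd {n m : ℕ} (G : SimpleGraph (Fin m)) (x : Config n) :
    NG G x = ∑ ψ : Fin m ↪ Fin n, copyProd x (edgesOf G) ψ := by
  classical
  unfold NG copyProd
  refine sum_congr rfl fun ψ _ => ?_
  have h1 : ∀ a b : Fin m, (if G.Adj a b then edgeInd x (ψ a) (ψ b) else 1 : ℝ)
      = if (G.Adj a b → pairVal x s(ψ a, ψ b) = true) then 1 else 0 := by
    intro a b
    by_cases h : G.Adj a b
    · simp only [h, if_true, forall_const]; rfl
    · simp [h]
  simp only [h1, prod_ite_zero, ind, prod_const_one, mem_univ, forall_const]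
  refine if_congr ?_ rfl rfl
  constructor
  · intro H q hq
    induction q using Sym2.ind with
    | _ a b => exact H a b ((mem_edgesOf G _).1 hq)
  · intro H a b hab
    exact H s(a, b) ((mem_edgesOf G _).2 hab)

/-- The number of copies of `A` in `x` whose embedding maps the root pair `g` to the edge `e`. -/
noncomputable def rooted {n m : ℕ} (x : Config n) (A : Finset (Sym2 (Fin m)))
    (g : Sym2 (Fin m)) (e : EdgeSet n) : ℝ :=
  ∑ ψ : Fin m ↪ Fin n, if g.map ψ = e.1 then copyProd x A ψ else 0

lemma rooted_mono {n m : ℕ} {x y : Config n} (h : x ≤ y) (A : Finset (Sym2 (Fin m)))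
    (g : Sym2 (Fin m)) (e : EdgeSet n) : rooted x A g e ≤ rooted y A g e := by
  refine sum_le_sum fun ψ _ => ?_
  split_ifs
  · exact copyProd_mono h A ψ
  · exact le_rfl

lemma map_embedding_injective {n m : ℕ} (ψ : Fin m ↪ Fin n) :
    Function.Injective (Sym2.map ψ) := Sym2.map.injective ψ.injective

lemma copyProd_update_sub {n m : ℕ} (x : Config n) (E : Finset (Sym2 (Fin m)))
    (e : EdgeSet n) (ψ : Fin m ↪ Fin n) :
    copyProd (Function.update x e true) E ψ - copyProd (Function.update x e false) E ψ
      = ∑ g ∈ E, if g.map ψ = e.1 then copyProd x (E.erase g) ψ else 0 := by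
  have herase : ∀ (b : Bool) (g : Sym2 (Fin m)), g.map ψ = e.1 →
      copyProd (Function.update x e b) (E.erase g) ψ = copyProd x (E.erase g) ψ := by
    intro b g hg
    refine prod_congr rfl fun h hh => ind_update_of_ne x e b fun h' => ?_
    exact (mem_erase.1 hh).1 (map_embedding_injective ψ (h'.trans hg.symm))
  by_cases H : ∃ g ∈ E, g.map ψ = e.1
  · obtain ⟨g, hg, hge⟩ := H
    rw [sum_eq_single_of_mem g hg, if_pos hge]
    · have : ∀ b, copyProd (Function.update x e b) E ψ
          = (if b = true then 1 else 0) * copyProd x (E.erase g) ψ := by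
        intro b
        rw [← herase b g hge, copyProd, ← mul_prod_erase E _ hg, hge, ind_update_self]
        rfl
      simp [this]
    · intro h _ hne
      exact if_neg fun h' => hne (map_embedding_injective ψ (h'.trans hge.symm))
  · push Not at H
    rw [sum_eq_zero fun g hg => if_neg (H g hg), sub_eq_zero]
    refine prod_congr rfl fun h hh => ?_
    rw [ind_update_of_ne _ _ _ (H h hh), ind_update_of_ne _ _ _ (H h hh)]

lemma dHam_eq {n s : ℕ} (V : Fin s → ℕ) (G : ∀ i, SimpleGraph (Fin (V i)))
    (β : Fin s → ℝ) (e : EdgeSet n) (x : Config n) :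
    dHam V G β e x = ∑ i, β i / (n : ℝ) ^ (V i - 2) *
      ∑ g ∈ edgesOf (G i), rooted x ((edgesOf (G i)).erase g) g e := by
  unfold dHam Hamiltonian
  rw [← sum_sub_distrib]
  refine sum_congr rfl fun i _ => ?_
  have : NG (G i) (Function.update x e true) - NG (G i) (Function.update x e false)
      = ∑ g ∈ edgesOf (G i), rooted x ((edgesOf (G i)).erase g) g e := by
    rw [NG_eq_sum_copyProd, NG_eq_sum_copyProd, ← sum_sub_distrib]
    simp only [copyProd_update_sub, rooted]
    exact sum_comm
  rw [← this]
  ring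

lemma dHam_mono {n s : ℕ} (V : Fin s → ℕ) (G : ∀ i, SimpleGraph (Fin (V i)))
    {β : Fin s → ℝ} (hβ : ∀ i, 0 < β i) (e : EdgeSet n) {x y : Config n} (h : x ≤ y) :
    dHam V G β e x ≤ dHam V G β e y := by
  rw [dHam_eq, dHam_eq]
  refine sum_le_sum fun i _ => mul_le_mul_of_nonneg_left
    (sum_le_sum fun g _ => rooted_mono h _ g e) ?_
  exact div_nonneg (hβ i).le (by positivity)

/-- The number of vertices outside `F` that are adjacent in `x` to all vertices of `S`. -/
noncomputable def common {n : ℕ} (x : Config n) (F S : Finset (Fin n)) : ℕ :=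
  (Fᶜ.filter fun y => ∀ s ∈ S, pairVal x s(y, s) = true).card

/-- Removing one vertex `w` from an embedding: the sum over the image of `w` of the adjacency
indicators to the images of `S` is a common neighbour count. -/
lemma exists_fiber_sum {n m : ℕ} (w : Fin m) (S : Finset (Fin m)) (hw : w ∉ S)
    (Q : (Fin m ↪ Fin n) → ℝ) (hQ0 : ∀ ψ, 0 ≤ Q ψ)
    (hQ : ∀ ψ ψ' : Fin m ↪ Fin n, (∀ z, z ≠ w → ψ z = ψ' z) → Q ψ = Q ψ') :
    ∃ (Q' : ({z // z ≠ w} ↪ Fin n) → ℝ) (F S' : ({z // z ≠ w} ↪ Fin n) → Finset (Fin n)),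
      (∀ f, 0 ≤ Q' f ∧ (F f).card = m - 1 ∧ S' f ⊆ F f ∧ (S' f).card = S.card) ∧
      ∑ ψ, Q ψ = ∑ f, Q' f * ((n : ℝ) - (F f).card) ∧
      ∀ x : Config n, ∑ ψ, Q ψ * ∏ s ∈ S, ind x s(ψ w, ψ s)
        = ∑ f, Q' f * (common x (F f) (S' f) : ℝ) := by
  classical
  let eqv : (Fin m ↪ Fin n) ≃ Σ f : {z // z ≠ w} ↪ Fin n, ↥(Set.range f)ᶜ :=
    (Equiv.embeddingCongr (Equiv.optionSubtypeNe w).symm (Equiv.refl _)).trans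
      (Function.Embedding.optionEmbeddingEquiv _ _)
  have hat : ∀ (f : {z // z ≠ w} ↪ Fin n) (y : ↥(Set.range f)ᶜ), eqv.symm ⟨f, y⟩ w = y.1 := by
    intro f y
    simp [eqv, Equiv.embeddingCongr, Function.Embedding.optionEmbeddingEquiv,
      Function.Embedding.congr]
  have hoff : ∀ (f : {z // z ≠ w} ↪ Fin n) (y : ↥(Set.range f)ᶜ) (z : Fin m) (hz : z ≠ w),
      eqv.symm ⟨f, y⟩ z = f ⟨z, hz⟩ := by
    intro f y z hz
    simp [eqv, Equiv.embeddingCongr, Function.Embedding.optionEmbeddingEquiv,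
      Function.Embedding.congr, hz]
  let Q' : ({z // z ≠ w} ↪ Fin n) → ℝ := fun f =>
    if h : Nonempty ↥(Set.range f)ᶜ then Q (eqv.symm ⟨f, h.some⟩) else 0
  have hQ' : ∀ (f : {z // z ≠ w} ↪ Fin n) (y : ↥(Set.range f)ᶜ), Q (eqv.symm ⟨f, y⟩) = Q' f := by
    intro f y
    have hne : Nonempty ↥(Set.range f)ᶜ := ⟨y⟩
    simp only [Q', dif_pos hne]
    exact hQ _ _ fun z hz => by rw [hoff f _ z hz, hoff f _ z hz]
  have hcard : ∀ f : {z // z ≠ w} ↪ Fin n, (univ.map f).card = m - 1 := by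
    intro f
    rw [card_map, card_univ, Fintype.card_subtype_compl, Fintype.card_fin,
      Fintype.card_subtype_eq]
  refine ⟨Q', fun f => univ.map f, fun f => (S.subtype fun z => z ≠ w).map f, ?_, ?_, ?_⟩
  · intro f
    refine ⟨?_, hcard f, map_subset_map.2 (subset_univ _), ?_⟩
    · simp only [Q']; split_ifs
      · exact hQ0 _
      · exact le_rfl
    · rw [card_map, card_subtype, filter_true_of_mem]
      rintro z hz rfl
      exact hw hz
  · rw [← Equiv.sum_comp eqv.symm, Fintype.sum_sigma]
    refine sum_congr rfl fun f _ => ?_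
    simp only [hQ', sum_const, nsmul_eq_mul]
    rw [mul_comm]
    congr 1
    have h1 : Fintype.card ↥(Set.range f)ᶜ = n - (univ.map f).card := by
      rw [Fintype.card_compl_set, Fintype.card_fin, Set.card_range_of_injective f.injective,
        card_map, card_univ]
    rw [card_univ, h1, Nat.cast_sub]
    simpa using card_le_univ (univ.map f)
  · intro x
    rw [← Equiv.sum_comp eqv.symm, Fintype.sum_sigma]
    refine sum_congr rfl fun f _ => ?_
    simp only [hQ', ← mul_sum]
    congr 1
    have h1 : ∀ y : ↥(Set.range f)ᶜ, ∏ s ∈ S, ind x s(eqv.symm ⟨f, y⟩ w, eqv.symm ⟨f, y⟩ s)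
        = if (∀ s ∈ (S.subtype fun z => z ≠ w).map f, pairVal x s(y.1, s) = true)
          then 1 else 0 := by
      intro y
      simp only [ind, prod_ite_zero, prod_const_one]
      refine if_congr ?_ rfl rfl
      rw [hat]
      constructor
      · intro H s hs
        obtain ⟨z, hz, rfl⟩ := mem_map.1 hs
        have := H z.1 (mem_subtype.1 hz)
        rwa [hoff f y z.1 z.2] at this
      · intro H s hs
        have hsw : s ≠ w := fun h => hw (h ▸ hs)
        rw [hoff f y s hsw]
        exact H _ (mem_map.2 ⟨⟨s, hsw⟩, mem_subtype.2 hs, rfl⟩)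
    simp only [h1]
    rw [common, card_filter, Nat.cast_sum]
    simp only [Nat.cast_ite, Nat.cast_one, Nat.cast_zero]
    rw [← Finset.sum_subtype (univ.map f)ᶜ (p := fun y => y ∈ (Set.range f)ᶜ)
      (f := fun y => if (∀ s ∈ (S.subtype fun z => z ≠ w).map f, pairVal x s(y, s) = true)
          then (1 : ℝ) else 0)]
    intro y; simp

/-- Every set of at most `L` vertices has at most as many common neighbours as in a random graph
of density `b`. -/
def UpperRegular {n : ℕ} (L : ℕ) (b : ℝ) (x : Config n) : Prop :=
  ∀ F S : Finset (Fin n), F.card ≤ L → S ⊆ F →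
    (common x F S : ℝ) ≤ ((n : ℝ) - F.card) * b ^ S.card

/-- Every set of at most `L` vertices has at least as many common neighbours as in a random graph
of density `a`. -/
def LowerRegular {n : ℕ} (L : ℕ) (a : ℝ) (x : Config n) : Prop :=
  ∀ F S : Finset (Fin n), F.card ≤ L → S ⊆ F →
    ((n : ℝ) - F.card) * a ^ S.card ≤ (common x F S : ℝ)

lemma exists_rooted_fiber_sum {n m : ℕ} (x : Config n) (A : Finset (Sym2 (Fin m)))
    (g : Sym2 (Fin m)) (e : EdgeSet n) (hA : A.Nonempty) (hdiag : ∀ h ∈ A, ¬ h.IsDiag)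
    (hg : g ∉ A) :
    ∃ (B : Finset (Sym2 (Fin m))) (k : ℕ), B ⊂ A ∧ B.card + k = A.card ∧
    ∃ (ι : Type) (_ : Fintype ι) (Q' : ι → ℝ) (F S' : ι → Finset (Fin n)),
      (∀ f, 0 ≤ Q' f ∧ (F f).card = m - 1 ∧ S' f ⊆ F f ∧ (S' f).card = k) ∧
      rooted x B g e = ∑ f, Q' f * ((n : ℝ) - (F f).card) ∧
      rooted x A g e = ∑ f, Q' f * (common x (F f) (S' f) : ℝ) := by
  classical
  obtain ⟨h, hh⟩ := hA
  have hw : ∃ w, w ∈ h ∧ w ∉ g := by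
    by_contra! H
    induction h using Sym2.ind with
    | _ p q =>
      have hpq : p ≠ q := fun h' => hdiag _ hh (by simp [h'])
      have := (Sym2.mem_and_mem_iff hpq).1 ⟨H p (by simp), H q (by simp)⟩
      exact hg (this ▸ hh)
  obtain ⟨w, hwh, hwg⟩ := hw
  let S : Finset (Fin m) := univ.filter fun s => s(w, s) ∈ A
  have hwS : w ∉ S := fun H => hdiag _ (mem_filter.1 H).2 (by simp)
  have hinj : Set.InjOn (fun s => s(w, s)) (S : Set (Fin m)) := fun a _ b _ hab =>
    Sym2.congr_right.1 hab
  have himg : A.filter (fun h => w ∈ h) = S.image (fun s => s(w, s)) := by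
    ext q
    simp only [mem_filter, mem_image, S, mem_univ, true_and]
    constructor
    · rintro ⟨hq, y, rfl⟩
      exact ⟨y, hq, rfl⟩
    · rintro ⟨s, hs, rfl⟩
      exact ⟨hs, by simp⟩
  have hcard : (A.filter fun h => w ∈ h).card = S.card := by
    rw [himg, card_image_of_injOn hinj]
  refine ⟨A.filter (fun h => w ∉ h), S.card, ?_, ?_, ?_⟩
  · refine filter_ssubset.2 ⟨h, hh, by simpa using hwh⟩
  · rw [← hcard, add_comm, card_filter_add_card_filter_not]
  · obtain ⟨Q', F, S', h1, h2, h3⟩ := exists_fiber_sum w S hwS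
      (fun ψ : Fin m ↪ Fin n =>
        if g.map ψ = e.1 then copyProd x (A.filter fun h => w ∉ h) ψ else 0)
      (fun ψ => by
        split_ifs
        · exact copyProd_nonneg _ _ _
        · exact le_rfl)
      (fun ψ ψ' hψ => by
        have hmap : ∀ q : Sym2 (Fin m), w ∉ q → q.map ψ = q.map ψ' := fun q hq =>
          Sym2.map_congr fun z hz => hψ z fun h' => hq (h' ▸ hz)
        rw [hmap g hwg]
        split_ifs
        · exact prod_congr rfl fun q hq => by rw [hmap q (mem_filter.1 hq).2]
        · rfl)
    refine ⟨_, inferInstance, Q', F, S', h1, h2, ?_⟩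
    rw [← h3 x, rooted]
    refine sum_congr rfl fun ψ _ => ?_
    rw [ite_mul, zero_mul]
    refine if_congr Iff.rfl ?_ rfl
    rw [copyProd, ← prod_filter_mul_prod_filter_not A (fun h => w ∈ h), mul_comm, himg,
      prod_image hinj]
    rfl

lemma rooted_le {n m L : ℕ} (x : Config n) {b : ℝ} (hb : 0 ≤ b) (hx : UpperRegular L b x)
    (hm : m ≤ L) (A : Finset (Sym2 (Fin m))) (g : Sym2 (Fin m)) (e : EdgeSet n)
    (hdiag : ∀ h ∈ A, ¬ h.IsDiag) (hg : g ∉ A) :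
    rooted x A g e ≤ b ^ A.card * rooted x ∅ g e := by
  induction A using Finset.strongInduction with
  | H A ih =>
    rcases A.eq_empty_or_nonempty with rfl | hA
    · simp
    · obtain ⟨B, k, hBA, hk, ι, _, Q', F, S', h1, h2, h3⟩ :=
        exists_rooted_fiber_sum x A g e hA hdiag hg
      have hB := ih B hBA (fun h hh => hdiag h (hBA.1 hh)) (fun h => hg (hBA.1 h))
      calc rooted x A g e = ∑ f, Q' f * (common x (F f) (S' f) : ℝ) := h3
        _ ≤ ∑ f, b ^ k * (Q' f * ((n : ℝ) - (F f).card)) := by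
            refine sum_le_sum fun f _ => ?_
            obtain ⟨q0, q1, q2, q3⟩ := h1 f
            have := hx (F f) (S' f) (by omega) q2
            rw [q3] at this
            calc _ ≤ Q' f * (((n : ℝ) - (F f).card) * b ^ k) :=
                  mul_le_mul_of_nonneg_left this q0
              _ = _ := by ring
        _ = b ^ k * rooted x B g e := by rw [h2, mul_sum]
        _ ≤ b ^ k * (b ^ B.card * rooted x ∅ g e) :=
            mul_le_mul_of_nonneg_left hB (by positivity)
        _ = b ^ A.card * rooted x ∅ g e := by rw [← hk, pow_add]; ring

lemma le_rooted {n m L : ℕ} (x : Config n) {a : ℝ} (ha : 0 ≤ a) (hx : LowerRegular L a x)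
    (hm : m ≤ L) (A : Finset (Sym2 (Fin m))) (g : Sym2 (Fin m)) (e : EdgeSet n)
    (hdiag : ∀ h ∈ A, ¬ h.IsDiag) (hg : g ∉ A) :
    a ^ A.card * rooted x ∅ g e ≤ rooted x A g e := by
  induction A using Finset.strongInduction with
  | H A ih =>
    rcases A.eq_empty_or_nonempty with rfl | hA
    · simp
    · obtain ⟨B, k, hBA, hk, ι, _, Q', F, S', h1, h2, h3⟩ :=
        exists_rooted_fiber_sum x A g e hA hdiag hg
      have hB := ih B hBA (fun h hh => hdiag h (hBA.1 hh)) (fun h => hg (hBA.1 h))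
      calc a ^ A.card * rooted x ∅ g e = a ^ k * (a ^ B.card * rooted x ∅ g e) := by
            rw [← hk, pow_add]; ring
        _ ≤ a ^ k * rooted x B g e := mul_le_mul_of_nonneg_left hB (by positivity)
        _ = ∑ f, a ^ k * (Q' f * ((n : ℝ) - (F f).card)) := by rw [h2, mul_sum]
        _ ≤ ∑ f, Q' f * (common x (F f) (S' f) : ℝ) := by
            refine sum_le_sum fun f _ => ?_
            obtain ⟨q0, q1, q2, q3⟩ := h1 f
            have := hx (F f) (S' f) (by omega) q2
            rw [q3] at this
            calc _ = Q' f * (((n : ℝ) - (F f).card) * a ^ k) := by ring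
              _ ≤ _ := mul_le_mul_of_nonneg_left this q0
        _ = rooted x A g e := h3.symm

lemma rooted_empty {n m : ℕ} (x : Config n) (g : Sym2 (Fin m)) (e : EdgeSet n) :
    rooted x ∅ g e = ∑ ψ : Fin m ↪ Fin n, if g.map ψ = e.1 then 1 else 0 := by
  simp [rooted, copyProd]

lemma exists_perm_map_eq {n : ℕ} (e f : EdgeSet n) :
    ∃ σ : Equiv.Perm (Fin n), e.1.map σ = f.1 := by
  obtain ⟨e, he⟩ := e
  obtain ⟨f, hf⟩ := f
  induction e using Sym2.ind with
  | _ i j =>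
    induction f using Sym2.ind with
    | _ k l =>
      have hij : i ≠ j := by simpa using he
      have hkl : k ≠ l := by simpa using hf
      have h1 : Equiv.swap i k j ≠ k := fun h => hij (by
        have := congrArg (Equiv.swap i k) h
        simpa using this.symm)
      refine ⟨(Equiv.swap i k).trans (Equiv.swap (Equiv.swap i k j) l), ?_⟩
      simp [Equiv.swap_apply_of_ne_of_ne h1.symm hkl]

lemma rooted_empty_eq {n m : ℕ} (x : Config n) (g : Sym2 (Fin m)) (e f : EdgeSet n) :
    rooted x ∅ g e = rooted x ∅ g f := by
  obtain ⟨σ, hσ⟩ := exists_perm_map_eq e f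
  symm
  rw [rooted_empty, rooted_empty,
    ← Equiv.sum_comp (Equiv.embeddingCongr (Equiv.refl (Fin m)) σ)]
  refine sum_congr rfl fun ψ _ => if_congr ?_ rfl rfl
  have : g.map (Equiv.embeddingCongr (Equiv.refl (Fin m)) σ ψ) = (g.map ψ).map σ := by
    rw [Sym2.map_map]
    rfl
  rw [this, ← hσ]
  exact (Sym2.map.injective σ.injective).eq_iff

lemma not_isDiag_map {n m : ℕ} (ψ : Fin m ↪ Fin n) {g : Sym2 (Fin m)} (hg : ¬ g.IsDiag) :
    ¬ (g.map ψ).IsDiag := by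
  induction g using Sym2.ind with
  | _ i j => simpa using hg

lemma sum_ite_map_eq {n m : ℕ} (ψ : Fin m ↪ Fin n) {g : Sym2 (Fin m)} (hg : ¬ g.IsDiag)
    (c : EdgeSet n → ℝ) :
    ∑ e : EdgeSet n, (if g.map ψ = e.1 then c e else 0) = c ⟨g.map ψ, not_isDiag_map ψ hg⟩ := by
  rw [sum_eq_single ⟨g.map ψ, not_isDiag_map ψ hg⟩]
  · simp
  · intro e _ he
    exact if_neg fun h => he (Subtype.ext h.symm)
  · simp

lemma card_edgeSet (n : ℕ) : Fintype.card (EdgeSet n) = n.choose 2 := by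
  have := Sym2.card_subtype_not_diag (α := Fin n)
  rw [Fintype.card_fin] at this
  rw [← this]

lemma two_mul_card_edgeSet (n : ℕ) :
    2 * (Fintype.card (EdgeSet n) : ℝ) = (n : ℝ) * (n - 1) := by
  rw [card_edgeSet, Nat.cast_choose_two]
  ring

lemma rooted_empty_eq_descFactorial {n m : ℕ} (hm : 2 ≤ m) (x : Config n) {g : Sym2 (Fin m)}
    (hg : ¬ g.IsDiag) (e : EdgeSet n) :
    rooted x ∅ g e = 2 * ((n - 2).descFactorial (m - 2) : ℝ) := by
  have hn : 2 ≤ n := by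
    by_contra h
    have : Fintype.card (EdgeSet n) = 0 := by
      rw [card_edgeSet]; exact Nat.choose_eq_zero_of_lt (by omega)
    exact (Fintype.card_eq_zero_iff.1 this).false e
  have h1 : (Fintype.card (EdgeSet n) : ℝ) * rooted x ∅ g e = n.descFactorial m := by
    have hcard : Fintype.card (Fin m ↪ Fin n) = n.descFactorial m := by
      rw [Fintype.card_embedding_eq, Fintype.card_fin, Fintype.card_fin]
    rw [← hcard]
    calc (Fintype.card (EdgeSet n) : ℝ) * rooted x ∅ g e
        = ∑ f : EdgeSet n, rooted x ∅ g f := by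
          rw [sum_congr rfl fun f _ => rooted_empty_eq x g f e]
          simp
      _ = ∑ ψ : Fin m ↪ Fin n, ∑ f : EdgeSet n, if g.map ψ = f.1 then 1 else 0 := by
          simp only [rooted_empty]; exact sum_comm
      _ = _ := by
          simp [sum_ite_map_eq _ hg (fun _ => (1 : ℝ))]
  obtain ⟨k, rfl⟩ : ∃ k, m = k + 2 := ⟨m - 2, by omega⟩
  obtain ⟨l, rfl⟩ : ∃ l, n = l + 2 := ⟨n - 2, by omega⟩
  rw [Nat.succ_descFactorial_succ, Nat.succ_descFactorial_succ] at h1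
  have h2 := two_mul_card_edgeSet (l + 2)
  push_cast at h1 h2
  have h3 : ((l : ℝ) + 2) * (l + 1) ≠ 0 := by positivity
  apply mul_left_cancel₀ h3
  simp only [Nat.add_sub_cancel]
  linear_combination 2 * h1 - rooted x ∅ g e * h2

lemma rooted_empty_le {n m : ℕ} (hm : 2 ≤ m) (x : Config n) {g : Sym2 (Fin m)}
    (hg : ¬ g.IsDiag) (e : EdgeSet n) : rooted x ∅ g e ≤ 2 * (n : ℝ) ^ (m - 2) := by
  rw [rooted_empty_eq_descFactorial hm x hg]
  have h := (Nat.descFactorial_le_pow (n - 2) (m - 2)).trans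
    (Nat.pow_le_pow_left (Nat.sub_le n 2) (m - 2))
  gcongr
  exact_mod_cast h

lemma le_rooted_empty {n m L : ℕ} (hm : 2 ≤ m) (hmL : m ≤ L) (hL : L ≤ n) (x : Config n)
    {g : Sym2 (Fin m)} (hg : ¬ g.IsDiag) (e : EdgeSet n) :
    2 * ((1 - (L : ℝ) / n) ^ L * (n : ℝ) ^ (m - 2)) ≤ rooted x ∅ g e := by
  rw [rooted_empty_eq_descFactorial hm x hg]
  have hn : (0 : ℝ) < n := by exact_mod_cast (by omega : 0 < n)
  have h := (Nat.pow_le_pow_left (show n - L ≤ n - 2 + 1 - (m - 2) by omega) (m - 2)).trans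
    (Nat.pow_sub_le_descFactorial (n - 2) (m - 2))
  have h' : ((n : ℝ) - L) ^ (m - 2) ≤ ((n - 2).descFactorial (m - 2) : ℝ) := by
    rw [← Nat.cast_sub hL]; exact_mod_cast h
  have h0 : 0 ≤ 1 - (L : ℝ) / n := by
    rw [sub_nonneg, div_le_one hn]; exact_mod_cast hL
  have h01 : 1 - (L : ℝ) / n ≤ 1 := by
    have : 0 ≤ (L : ℝ) / n := by positivity
    linarith
  have h2 : (1 - (L : ℝ) / n) ^ L * (n : ℝ) ^ (m - 2) ≤ ((n : ℝ) - L) ^ (m - 2) :=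
    calc _ ≤ (1 - (L : ℝ) / n) ^ (m - 2) * (n : ℝ) ^ (m - 2) := by
          gcongr ?_ * _
          exact pow_le_pow_of_le_one h0 h01 (by omega)
      _ = ((n : ℝ) - L) ^ (m - 2) := by
          rw [← mul_pow]; congr 1; field_simp
  linarith

lemma two_le_of_mem_edgesOf {m : ℕ} {G : SimpleGraph (Fin m)} {h : Sym2 (Fin m)}
    (hh : h ∈ edgesOf G) : 2 ≤ m := by
  have := not_isDiag_of_mem_edgesOf hh
  induction h using Sym2.ind with
  | _ i j =>
    have hij : i ≠ j := by simpa using this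
    have := Fin.val_ne_of_ne hij
    omega

lemma dHam_le_Psi {n s L : ℕ} (V : Fin s → ℕ) (G : ∀ i, SimpleGraph (Fin (V i)))
    {β : Fin s → ℝ} (hβ : ∀ i, 0 < β i) (hV : ∀ i, V i ≤ L) {b : ℝ} (hb : 0 ≤ b) (x : Config n)
    (hx : UpperRegular L b x) (e : EdgeSet n) (hn : 0 < n) : dHam V G β e x ≤ Psi V G β b := by
  rw [dHam_eq, Psi]
  refine sum_le_sum fun i _ => ?_
  have h1 : ∑ g ∈ edgesOf (G i), rooted x ((edgesOf (G i)).erase g) g e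
      ≤ (numEdges (G i) : ℝ) * (b ^ (numEdges (G i) - 1) * (2 * (n : ℝ) ^ (V i - 2))) := by
    rw [← card_edgesOf, ← nsmul_eq_mul, ← sum_const]
    refine sum_le_sum fun g hg => ?_
    rw [← card_erase_of_mem hg]
    refine (rooted_le x hb hx (hV i) _ g e (fun h hh => not_isDiag_of_mem_edgesOf
      (mem_of_mem_erase hh)) (notMem_erase g _)).trans ?_
    gcongr
    exact rooted_empty_le (two_le_of_mem_edgesOf hg) x (not_isDiag_of_mem_edgesOf hg) e
  have hβi := hβ i
  calc _ ≤ β i / (n : ℝ) ^ (V i - 2) * ((numEdges (G i) : ℝ) *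
        (b ^ (numEdges (G i) - 1) * (2 * (n : ℝ) ^ (V i - 2)))) := by gcongr
    _ = _ := by field_simp

lemma Psi_le_dHam {n s L : ℕ} (V : Fin s → ℕ) (G : ∀ i, SimpleGraph (Fin (V i)))
    {β : Fin s → ℝ} (hβ : ∀ i, 0 < β i) (hV : ∀ i, V i ≤ L) {a : ℝ} (ha : 0 ≤ a) (x : Config n)
    (hx : LowerRegular L a x) (e : EdgeSet n) (hn : 0 < n) (hL : L ≤ n) :
    (1 - (L : ℝ) / n) ^ L * Psi V G β a ≤ dHam V G β e x := by
  rw [dHam_eq, Psi, mul_sum]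
  refine sum_le_sum fun i _ => ?_
  have h1 : (numEdges (G i) : ℝ) * (a ^ (numEdges (G i) - 1) *
      (2 * ((1 - (L : ℝ) / n) ^ L * (n : ℝ) ^ (V i - 2)))) ≤
      ∑ g ∈ edgesOf (G i), rooted x ((edgesOf (G i)).erase g) g e := by
    rw [← card_edgesOf, ← nsmul_eq_mul, ← sum_const]
    refine sum_le_sum fun g hg => ?_
    rw [← card_erase_of_mem hg]
    refine le_trans ?_ (le_rooted x ha hx (hV i) _ g e (fun h hh => not_isDiag_of_mem_edgesOf
      (mem_of_mem_erase hh)) (notMem_erase g _))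
    gcongr
    exact le_rooted_empty (two_le_of_mem_edgesOf hg) (hV i) hL x
      (not_isDiag_of_mem_edgesOf hg) e
  have hβi := hβ i
  calc _ = β i / (n : ℝ) ^ (V i - 2) * ((numEdges (G i) : ℝ) * (a ^ (numEdges (G i) - 1) *
      (2 * ((1 - (L : ℝ) / n) ^ L * (n : ℝ) ^ (V i - 2))))) := by field_simp
    _ ≤ _ := by gcongr

lemma prod_sub_prod_le {ι : Type*} [DecidableEq ι] (A : Finset ι) (u v : ι → ℝ)
    (h0 : ∀ i, 0 ≤ u i) (huv : ∀ i, u i ≤ v i) :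
    ∏ i ∈ A, v i - ∏ i ∈ A, u i ≤ ∑ i ∈ A, (v i - u i) * ∏ j ∈ A.erase i, v j := by
  induction A using Finset.induction_on with
  | empty => simp
  | insert a A ha ih =>
    rw [prod_insert ha, prod_insert ha, sum_insert ha, erase_insert ha]
    have h1 : ∑ i ∈ A, (v i - u i) * ∏ j ∈ (insert a A).erase i, v j
        = v a * ∑ i ∈ A, (v i - u i) * ∏ j ∈ A.erase i, v j := by
      rw [mul_sum]
      refine sum_congr rfl fun i hi => ?_
      have hia : a ≠ i := fun h => ha (h ▸ hi)
      rw [erase_insert_of_ne hia, prod_insert (fun h => ha (mem_of_mem_erase h))]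
      ring
    have h2 : 0 ≤ v a := (h0 a).trans (huv a)
    have h3 : ∏ i ∈ A, u i ≤ ∏ i ∈ A, v i := prod_le_prod (fun i _ => h0 i) fun i _ => huv i
    rw [h1]
    nlinarith [mul_le_mul_of_nonneg_left ih h2,
      mul_le_mul_of_nonneg_left h3 (sub_nonneg.2 (huv a))]

/-- The formal derivative of `Psi`. -/
noncomputable def PsiDeriv {s : ℕ} (V : Fin s → ℕ) (G : ∀ i, SimpleGraph (Fin (V i)))
    (β : Fin s → ℝ) (p : ℝ) : ℝ :=
  ∑ i, 2 * β i * (numEdges (G i) : ℝ) *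
    (((numEdges (G i) - 1 : ℕ) : ℝ) * p ^ (numEdges (G i) - 1 - 1))

lemma hasDerivAt_Psi {s : ℕ} (V : Fin s → ℕ) (G : ∀ i, SimpleGraph (Fin (V i)))
    (β : Fin s → ℝ) (p : ℝ) : HasDerivAt (Psi V G β) (PsiDeriv V G β p) p := by
  unfold Psi PsiDeriv
  exact HasDerivAt.fun_sum fun i _ => (hasDerivAt_pow _ p).const_mul _

lemma sum_rooted_sub_le {n m L : ℕ} {x y : Config n} (hxy : x ≤ y) {b : ℝ} (hb : 0 ≤ b)
    (hy : UpperRegular L b y) (hm2 : 2 ≤ m) (hm : m ≤ L) (A : Finset (Sym2 (Fin m)))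
    (g : Sym2 (Fin m)) (hg : ¬ g.IsDiag) (hdiag : ∀ h ∈ A, ¬ h.IsDiag) :
    ∑ e, (rooted y A g e - rooted x A g e) ≤
      (A.card : ℝ) * (b ^ (A.card - 1) * (2 * (n : ℝ) ^ (m - 2))) *
        ∑ f : EdgeSet n, (ind y f.1 - ind x f.1) := by
  have h1 : ∀ z : Config n, ∑ e, rooted z A g e = ∑ ψ : Fin m ↪ Fin n, copyProd z A ψ := by
    intro z
    unfold rooted
    rw [sum_comm]
    exact sum_congr rfl fun ψ _ => sum_ite_map_eq ψ hg fun _ => copyProd z A ψ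
  rw [sum_sub_distrib, h1, h1, ← sum_sub_distrib]
  calc ∑ ψ : Fin m ↪ Fin n, (copyProd y A ψ - copyProd x A ψ)
      ≤ ∑ ψ : Fin m ↪ Fin n, ∑ h ∈ A,
          (ind y (h.map ψ) - ind x (h.map ψ)) * copyProd y (A.erase h) ψ :=
        sum_le_sum fun ψ _ => prod_sub_prod_le A (fun h => ind x (h.map ψ))
          (fun h => ind y (h.map ψ)) (fun _ => ind_nonneg _ _) fun _ => ind_mono hxy _
    _ = ∑ h ∈ A, ∑ f : EdgeSet n, (ind y f.1 - ind x f.1) * rooted y (A.erase h) h f := by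
        rw [sum_comm]
        refine sum_congr rfl fun h hh => ?_
        simp only [rooted, mul_sum, mul_ite, mul_zero]
        rw [sum_comm]
        refine sum_congr rfl fun ψ _ => ?_
        rw [sum_ite_map_eq ψ (hdiag h hh)
          fun f => (ind y f.1 - ind x f.1) * copyProd y (A.erase h) ψ]
    _ ≤ ∑ h ∈ A, ∑ f : EdgeSet n, (ind y f.1 - ind x f.1) *
          (b ^ (A.card - 1) * (2 * (n : ℝ) ^ (m - 2))) := by
        refine sum_le_sum fun h hh => sum_le_sum fun f _ =>
          mul_le_mul_of_nonneg_left ?_ (sub_nonneg.2 (ind_mono hxy _))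
        rw [← card_erase_of_mem hh]
        refine (rooted_le y hb hy hm _ h f (fun q hq => hdiag q (mem_of_mem_erase hq))
          (notMem_erase h _)).trans ?_
        gcongr
        exact rooted_empty_le hm2 y (hdiag h hh) f
    _ = _ := by
        rw [sum_const, nsmul_eq_mul, ← sum_mul]
        ring

lemma sum_dHam_sub_le {n s L : ℕ} (V : Fin s → ℕ) (G : ∀ i, SimpleGraph (Fin (V i)))
    {β : Fin s → ℝ} (hβ : ∀ i, 0 < β i) (hV : ∀ i, V i ≤ L) {b : ℝ} (hb : 0 ≤ b)
    {x y : Config n} (hxy : x ≤ y) (hy : UpperRegular L b y) (hn : 0 < n) :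
    ∑ e, (dHam V G β e y - dHam V G β e x) ≤
      PsiDeriv V G β b * ∑ f : EdgeSet n, (ind y f.1 - ind x f.1) := by
  simp only [dHam_eq, ← sum_sub_distrib, ← mul_sub]
  rw [sum_comm, PsiDeriv, sum_mul]
  refine sum_le_sum fun i _ => ?_
  set D := ∑ f : EdgeSet n, (ind y f.1 - ind x f.1) with hD
  have hβi := hβ i
  rw [← mul_sum, sum_comm]
  have h1 : ∑ g ∈ edgesOf (G i), ∑ e, (rooted y ((edgesOf (G i)).erase g) g e
        - rooted x ((edgesOf (G i)).erase g) g e)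
      ≤ (numEdges (G i) : ℝ) * (((numEdges (G i) - 1 : ℕ) : ℝ) *
        (b ^ (numEdges (G i) - 1 - 1) * (2 * (n : ℝ) ^ (V i - 2))) * D) := by
    rw [← card_edgesOf, ← nsmul_eq_mul, ← sum_const]
    refine sum_le_sum fun g hg => ?_
    rw [← card_erase_of_mem hg]
    exact sum_rooted_sub_le hxy hb hy (two_le_of_mem_edgesOf hg) (hV i) _ g
      (not_isDiag_of_mem_edgesOf hg)
      fun h hh => not_isDiag_of_mem_edgesOf (mem_of_mem_erase hh)
  calc _ ≤ β i / (n : ℝ) ^ (V i - 2) * ((numEdges (G i) : ℝ) *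
        (((numEdges (G i) - 1 : ℕ) : ℝ) *
        (b ^ (numEdges (G i) - 1 - 1) * (2 * (n : ℝ) ^ (V i - 2))) * D)) := by gcongr
    _ = _ := by field_simp

section Driven

variable {Ω α : Type*} [MeasurableSpace Ω] [Fintype α]

/-- The transition operator on observables of the Markov chain that is driven by `step` and
independent seeds of law `μ`. -/
noncomputable def avg (μ : Measure Ω) (step : Ω → α → α) : Module.End ℝ (α → ℝ) where
  toFun f a := ∑ b, μ.real {ω | step ω a = b} * f b
  map_add' f g := by ext a; simp [mul_add, sum_add_distrib]
  map_smul' c f := by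
    ext a
    simp only [Pi.smul_apply, smul_eq_mul, RingHom.id_apply, mul_sum]
    exact sum_congr rfl fun b _ => by ring

/-- The chain after `t` steps. -/
def drive (step : Ω → α → α) : (t : ℕ) → (Fin t → Ω) → α → α
  | 0, _, a => a
  | t + 1, ω, a => step (ω (Fin.last t)) (drive step t (fun i => ω i.castSucc) a)

lemma avg_le_avg_of_invariant (μ : Measure Ω) {step : Ω → α → α} {I : Set α}
    (hI : ∀ ω, ∀ a ∈ I, step ω a ∈ I) {f g : α → ℝ} (hfg : ∀ a ∈ I, f a ≤ g a) :
    ∀ a ∈ I, avg μ step f a ≤ avg μ step g a := by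
  intro a ha
  refine sum_le_sum fun b _ => ?_
  by_cases hb : b ∈ I
  · exact mul_le_mul_of_nonneg_left (hfg b hb) measureReal_nonneg
  · have : {ω | step ω a = b} = ∅ := by
      ext ω
      simp only [Set.mem_ofPred_eq, Set.mem_empty_iff_false, iff_false]
      exact fun h => hb (h ▸ hI ω a ha)
    simp [this]

lemma avg_pow_le_of_invariant (μ : Measure Ω) {step : Ω → α → α} {I : Set α}
    (hI : ∀ ω, ∀ a ∈ I, step ω a ∈ I) {f g : α → ℝ} (hfg : ∀ a ∈ I, f a ≤ g a) (t : ℕ) :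
    ∀ a ∈ I, (avg μ step ^ t) f a ≤ (avg μ step ^ t) g a := by
  induction t with
  | zero => simpa using hfg
  | succ t ih =>
    intro a ha
    rw [pow_succ', Module.End.mul_apply, Module.End.mul_apply]
    exact avg_le_avg_of_invariant μ hI ih a ha

lemma avg_pow_mono (μ : Measure Ω) (step : Ω → α → α) {f g : α → ℝ} (hfg : ∀ a, f a ≤ g a)
    (t : ℕ) (a : α) : (avg μ step ^ t) f a ≤ (avg μ step ^ t) g a :=
  avg_pow_le_of_invariant μ (I := Set.univ) (by simp) (fun a _ => hfg a) t a (Set.mem_univ a)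

variable [MeasurableSpace α] [MeasurableSingletonClass α]

lemma integrable_comp_of_fintype (μ : Measure Ω) [IsFiniteMeasure μ] (f : α → ℝ) {X : Ω → α}
    (hX : Measurable X) : Integrable (fun ω => f (X ω)) μ := by
  refine Integrable.of_bound ((measurable_of_countable f).comp hX).aestronglyMeasurable
    (∑ a, ‖f a‖) (ae_of_all _ fun ω => ?_)
  exact single_le_sum (f := fun a => ‖f a‖) (fun a _ => norm_nonneg _) (mem_univ (X ω))

lemma avg_apply (μ : Measure Ω) [IsFiniteMeasure μ] {step : Ω → α → α}
    (hstep : ∀ a, Measurable fun ω => step ω a) (f : α → ℝ) (a : α) :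
    avg μ step f a = ∫ ω, f (step ω a) ∂μ := by
  have hf := measurable_of_countable f
  rw [← integral_map (f := f) (hstep a).aemeasurable hf.aestronglyMeasurable,
    integral_fintype (Integrable.of_finite)]
  refine sum_congr rfl fun b _ => ?_
  rw [map_measureReal_apply (hstep a) (measurableSet_singleton b)]
  rfl

lemma avg_pow_const (μ : Measure Ω) [IsProbabilityMeasure μ] {step : Ω → α → α}
    (hstep : ∀ a, Measurable fun ω => step ω a) (c : ℝ) (t : ℕ) :
    (avg μ step ^ t) (fun _ => c) = fun _ => c := by
  induction t with
  | zero => simp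
  | succ t ih =>
    rw [pow_succ', Module.End.mul_apply, ih]
    ext a
    rw [avg_apply μ hstep]
    simp

lemma measurable_drive {step : Ω → α → α} (hstep : ∀ a, Measurable fun ω => step ω a)
    (t : ℕ) (a : α) : Measurable fun ω : Fin t → Ω => drive step t ω a := by
  have h2 : Measurable fun q : Ω × α => step q.1 q.2 :=
    measurable_from_prod_countable_left hstep
  induction t with
  | zero => exact measurable_const
  | succ t ih =>
    have h3 : Measurable fun ω : Fin (t + 1) → Ω => drive step t (fun i => ω i.castSucc) a :=
      ih.comp (measurable_pi_lambda _ fun i => measurable_pi_apply i.castSucc)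
    exact h2.comp ((measurable_pi_apply (Fin.last t)).prodMk h3)

lemma integral_drive (μ : Measure Ω) [IsProbabilityMeasure μ] {step : Ω → α → α}
    (hstep : ∀ a, Measurable fun ω => step ω a) (t : ℕ) (f : α → ℝ) (a : α) :
    ∫ ω, f (drive step t ω a) ∂(Measure.pi fun _ : Fin t => μ) = (avg μ step ^ t) f a := by
  induction t generalizing f with
  | zero => simp [drive]
  | succ t ih =>
    have h2 : Measurable fun q : Ω × α => step q.1 q.2 :=
      measurable_from_prod_countable_left hstep
    have hmp := measurePreserving_piFinSuccAbove (fun _ : Fin (t + 1) => μ) (Fin.last t)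
    have h3 : Measurable fun q : Ω × (Fin t → Ω) => step q.1 (drive step t q.2 a) :=
      h2.comp (measurable_fst.prodMk ((measurable_drive hstep t a).comp measurable_snd))
    have key := hmp.integral_comp' (g := fun q : Ω × (Fin t → Ω) =>
      f (step q.1 (drive step t q.2 a)))
    have h4 : ∀ ω : Fin (t + 1) → Ω, f (drive step (t + 1) ω a)
        = (fun q : Ω × (Fin t → Ω) => f (step q.1 (drive step t q.2 a)))
          (MeasurableEquiv.piFinSuccAbove (fun _ => Ω) (Fin.last t) ω) := by
      intro ω
      simp [drive, MeasurableEquiv.piFinSuccAbove]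
      rfl
    simp only [h4]
    rw [key, integral_prod_symm _ (integrable_comp_of_fintype _ f h3), pow_succ,
      Module.End.mul_apply, ← ih]
    simp only [avg_apply μ hstep]

end Driven

/-- One step of the chain that sets the coordinate `I` of `x` to `1` iff `U ≤ τ I x`. -/
noncomputable def thStep {n : ℕ} (τ : EdgeSet n → Config n → ℝ) (ω : EdgeSet n × ℝ)
    (x : Config n) : Config n := Function.update x ω.1 (decide (ω.2 ≤ τ ω.1 x))

/-- Several threshold chains driven by the same seed. -/
noncomputable def jointStep {n : ℕ} {ι : Type*} (τ : ι → EdgeSet n → Config n → ℝ)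
    (ω : EdgeSet n × ℝ) (σ : ι → Config n) : ι → Config n := fun i => thStep (τ i) ω (σ i)

lemma measurable_thStep {n : ℕ} (τ : EdgeSet n → Config n → ℝ) (x : Config n) :
    Measurable fun ω => thStep τ ω x := by
  refine measurable_from_prod_countable_right fun e => ?_
  have h : Measurable fun u : ℝ => decide (u ≤ τ e x) := by
    refine (measurable_to_bool ?_)
    have : (fun u : ℝ => decide (u ≤ τ e x)) ⁻¹' {true} = Set.Iic (τ e x) := by ext; simp
    rw [this]
    exact measurableSet_Iic
  exact (measurable_of_countable fun b : Bool => Function.update x e b).comp h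

lemma measurable_jointStep {n : ℕ} {ι : Type*} (τ : ι → EdgeSet n → Config n → ℝ)
    (σ : ι → Config n) : Measurable fun ω => jointStep τ ω σ :=
  measurable_pi_lambda _ fun i => measurable_thStep (τ i) (σ i)

lemma nonempty_edgeSet {n : ℕ} (hn : 2 ≤ n) : Nonempty (EdgeSet n) := by
  rw [← Fintype.card_pos_iff, card_edgeSet]
  exact Nat.choose_pos hn

lemma isProbabilityMeasure_seed {n : ℕ} (hn : 2 ≤ n) : IsProbabilityMeasure (seed n) := by
  have := nonempty_edgeSet hn
  have h1 : IsProbabilityMeasure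
      ((Fintype.card (EdgeSet n) : ℝ≥0∞)⁻¹ • (Measure.count : Measure (EdgeSet n))) := by
    constructor
    rw [Measure.smul_apply, Measure.count_univ, smul_eq_mul, ENat.card_eq_coe_fintype_card]
    rw [ENat.toENNReal_coe]
    exact ENNReal.inv_mul_cancel (Nat.cast_ne_zero.2 Fintype.card_ne_zero)
      (ENNReal.natCast_ne_top _)
  have h2 : IsProbabilityMeasure (volume.restrict (Set.Ioc (0 : ℝ) 1)) := ⟨by simp⟩
  unfold seed
  infer_instance

lemma integral_seed {n : ℕ} (hn : 2 ≤ n) {g : EdgeSet n × ℝ → ℝ} (hg : Integrable g (seed n)) :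
    ∫ ω, g ω ∂(seed n)
      = (Fintype.card (EdgeSet n) : ℝ)⁻¹ * ∑ e, ∫ u in Set.Ioc (0 : ℝ) 1, g (e, u) := by
  have := nonempty_edgeSet hn
  unfold seed at hg ⊢
  rw [integral_prod _ hg, integral_smul_measure, integral_count,
    ENNReal.toReal_inv, ENNReal.toReal_natCast, smul_eq_mul]

lemma setIntegral_decide {c : ℝ} (h0 : 0 ≤ c) (h1 : c ≤ 1) (F : Bool → ℝ) :
    ∫ u in Set.Ioc (0 : ℝ) 1, F (decide (u ≤ c)) = c * F true + (1 - c) * F false := by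
  have h : ∀ u : ℝ, F (decide (u ≤ c))
      = F false + (Set.Iic c).indicator (fun _ => F true - F false) u := by
    intro u
    by_cases hu : u ≤ c <;> simp [hu]
  simp only [h]
  rw [integral_add (integrable_const _) ((integrable_const _).indicator measurableSet_Iic),
    integral_indicator measurableSet_Iic, Measure.restrict_restrict measurableSet_Iic]
  have : Set.Iic c ∩ Set.Ioc 0 1 = Set.Ioc 0 c := by
    ext u; simp only [Set.mem_inter_iff, Set.mem_Iic, Set.mem_Ioc]
    constructor
    · rintro ⟨a, b, _⟩; exact ⟨b, a⟩
    · rintro ⟨a, b⟩; exact ⟨b, a, b.trans h1⟩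
  simp [this, h0]
  ring

lemma avg_thStep {n : ℕ} (hn : 2 ≤ n) {τ : EdgeSet n → Config n → ℝ}
    (h0 : ∀ e x, 0 ≤ τ e x) (h1 : ∀ e x, τ e x ≤ 1) (f : Config n → ℝ) (x : Config n) :
    avg (seed n) (thStep τ) f x = (Fintype.card (EdgeSet n) : ℝ)⁻¹ *
      ∑ e, (τ e x * f (Function.update x e true) + (1 - τ e x) * f (Function.update x e false))
    := by
  have := isProbabilityMeasure_seed hn
  rw [avg_apply _ (measurable_thStep τ),
    integral_seed hn (integrable_comp_of_fintype _ f (measurable_thStep τ x))]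
  congr 1
  refine sum_congr rfl fun e _ => ?_
  exact setIntegral_decide (h0 e x) (h1 e x) fun b => f (Function.update x e b)

/-- An observable of one component of a joint chain evolves by the operator of that component. -/
lemma avg_jointStep_pow {n : ℕ} (hn : 2 ≤ n) {ι : Type*} [Fintype ι] [DecidableEq ι]
    (τ : ι → EdgeSet n → Config n → ℝ) (i : ι) (f : Config n → ℝ) (t : ℕ)
    (σ : ι → Config n) :
    (avg (seed n) (jointStep τ) ^ t) (fun σ => f (σ i)) σ
      = (avg (seed n) (thStep (τ i)) ^ t) f (σ i) := by
  have := isProbabilityMeasure_seed hn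
  induction t generalizing f with
  | zero => simp
  | succ t ih =>
    rw [pow_succ, pow_succ, Module.End.mul_apply, Module.End.mul_apply, ← ih]
    have h : avg (seed n) (jointStep τ) (fun σ => f (σ i))
        = fun σ => avg (seed n) (thStep (τ i)) f (σ i) := by
      ext σ
      rw [avg_apply _ (measurable_jointStep τ), avg_apply _ (measurable_thStep (τ i))]
      rfl
    rw [h]

/-- The indicator that every edge of `A` is present. -/
noncomputable def allOpen {n : ℕ} (A : Finset (EdgeSet n)) (x : Config n) : ℝ :=
  ∏ e ∈ A, if x e = true then 1 else 0

/-- The edges joining `W` to `S`. -/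
noncomputable def starEdges {n : ℕ} (W S : Finset (Fin n)) : Finset (EdgeSet n) :=
  ((W ×ˢ S).image fun q => s(q.1, q.2)).subtype fun q => ¬ q.IsDiag

lemma injOn_star {n : ℕ} {W S : Finset (Fin n)} (h : Disjoint W S) :
    Set.InjOn (fun q : Fin n × Fin n => s(q.1, q.2)) (W ×ˢ S : Finset (Fin n × Fin n)) := by
  rintro ⟨a, b⟩ h1 ⟨c, d⟩ h2 h3
  simp only [coe_product, Set.mem_prod, mem_coe] at h1 h2
  rcases Sym2.eq_iff.1 h3 with ⟨rfl, rfl⟩ | ⟨rfl, rfl⟩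
  · rfl
  · exact absurd h2.2 (Finset.disjoint_left.1 h h1.1)

lemma filter_star {n : ℕ} {W S : Finset (Fin n)} (h : Disjoint W S) :
    ((W ×ˢ S).image fun q => s(q.1, q.2)).filter (fun q => ¬ q.IsDiag)
      = (W ×ˢ S).image fun q => s(q.1, q.2) := by
  refine filter_true_of_mem fun q hq => ?_
  obtain ⟨⟨a, b⟩, hab, rfl⟩ := mem_image.1 hq
  rw [mem_product] at hab
  rw [Sym2.mk_isDiag_iff]
  exact fun h' => Finset.disjoint_left.1 h hab.1 (h' ▸ hab.2)

lemma card_starEdges {n : ℕ} {W S : Finset (Fin n)} (h : Disjoint W S) :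
    (starEdges W S).card = W.card * S.card := by
  rw [starEdges, card_subtype, filter_star h, card_image_of_injOn (injOn_star h), card_product]

lemma allOpen_starEdges {n : ℕ} {W S : Finset (Fin n)} (h : Disjoint W S) (x : Config n) :
    allOpen (starEdges W S) x = ∏ w ∈ W, ∏ s ∈ S, ind x s(w, s) := by
  rw [← prod_product' (f := fun w s => ind x s(w, s)), ← prod_image (g := fun q : Fin n × Fin n =>
    s(q.1, q.2)) (f := fun q => ind x q) (injOn_star h), ← filter_star h,
    ← prod_subtype_eq_prod_filter]
  exact prod_congr rfl fun e _ => (ind_coe x e).symm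

lemma exp_mul_common {n : ℕ} (x : Config n) {F S : Finset (Fin n)} (hS : S ⊆ F) (θ : ℝ) :
    Real.exp (θ * common x F S)
      = ∑ W ∈ Fᶜ.powerset, (Real.exp θ - 1) ^ W.card * allOpen (starEdges W S) x := by
  have h1 : Real.exp (θ * common x F S)
      = ∏ w ∈ Fᶜ, (1 + (Real.exp θ - 1) * ∏ s ∈ S, ind x s(w, s)) := by
    rw [mul_comm, Real.exp_nat_mul, common, ← prod_const, prod_filter]
    refine prod_congr rfl fun w _ => ?_
    split_ifs with h
    · rw [prod_eq_one fun s hs => by rw [ind, if_pos (h s hs)]]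
      ring
    · push Not at h
      obtain ⟨s, hs, h⟩ := h
      rw [prod_eq_zero hs (by rw [ind, if_neg h])]
      ring
  rw [h1, prod_one_add]
  refine sum_congr rfl fun W hW => ?_
  have hd : Disjoint W S :=
    (disjoint_compl_left.mono_left (mem_powerset.1 hW)).mono_right hS
  rw [prod_mul_distrib, prod_const, allOpen_starEdges hd]

lemma exp_moment_le {n : ℕ} (E : (Config n → ℝ) →ₗ[ℝ] ℝ) {r θ : ℝ}
    (hE : ∀ (A : Finset (EdgeSet n)) (j : ℕ), (Real.exp θ - 1) ^ j * E (allOpen A)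
      ≤ (Real.exp θ - 1) ^ j * r ^ A.card) {F S : Finset (Fin n)} (hS : S ⊆ F) :
    E (fun x => Real.exp (θ * common x F S))
      ≤ (1 + (Real.exp θ - 1) * r ^ S.card) ^ (n - F.card) := by
  have h1 : (fun x : Config n => Real.exp (θ * common x F S))
      = ∑ W ∈ Fᶜ.powerset, (Real.exp θ - 1) ^ W.card • allOpen (starEdges W S) := by
    ext x
    rw [exp_mul_common x hS, Finset.sum_apply]
    rfl
  have h2 : (1 + (Real.exp θ - 1) * r ^ S.card) ^ (n - F.card)
      = ∑ W ∈ Fᶜ.powerset, (Real.exp θ - 1) ^ W.card * r ^ (W.card * S.card) := by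
    have : n - F.card = Fᶜ.card := by rw [card_compl, Fintype.card_fin]
    rw [this, ← prod_const, prod_one_add]
    refine sum_congr rfl fun W _ => ?_
    rw [prod_const, mul_pow, ← pow_mul, mul_comm S.card]
  rw [h1, h2, map_sum]
  refine sum_le_sum fun W hW => ?_
  have hd : Disjoint W S :=
    (disjoint_compl_left.mono_left (mem_powerset.1 hW)).mono_right hS
  rw [map_smul, smul_eq_mul, ← card_starEdges hd]
  exact hE _ _

open scoped Classical in
lemma deviation_le {n : ℕ} (E : (Config n → ℝ) →ₗ[ℝ] ℝ)
    (hmono : ∀ f g : Config n → ℝ, (∀ x, f x ≤ g x) → E f ≤ E g) {r θ η : ℝ}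
    (hr0 : 0 ≤ r) (hr1 : r ≤ 1) (hη : |θ| = η / 2) (hη2 : η ≤ 2)
    (hE : ∀ (A : Finset (EdgeSet n)) (j : ℕ), (Real.exp θ - 1) ^ j * E (allOpen A)
      ≤ (Real.exp θ - 1) ^ j * r ^ A.card) {F S : Finset (Fin n)} (hS : S ⊆ F) :
    E (fun x => if |θ| * η * ((n - F.card : ℕ) : ℝ)
        ≤ θ * (common x F S - r ^ S.card * ((n - F.card : ℕ) : ℝ)) then 1 else 0)
      ≤ Real.exp (-(η ^ 2 / 4 * ((n - F.card : ℕ) : ℝ))) := by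
  set N : ℕ := n - F.card
  have hk0 : 0 ≤ r ^ S.card := pow_nonneg hr0 _
  have hk1 : r ^ S.card ≤ 1 := pow_le_one₀ hr0 hr1
  set q : ℝ := r ^ S.card
  have hsq : θ ^ 2 = (η / 2) ^ 2 := by rw [← hη, sq_abs]
  have h1 : E (fun x => if |θ| * η * (N : ℝ) ≤ θ * (common x F S - q * N) then 1 else 0)
      ≤ E (Real.exp (-(θ * q * N) - |θ| * η * N) • fun x => Real.exp (θ * common x F S)) := by
    refine hmono _ _ fun x => ?_
    rw [Pi.smul_apply, smul_eq_mul, ← Real.exp_add]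
    split_ifs with h
    · rw [Real.one_le_exp_iff]; linarith
    · exact (Real.exp_pos _).le
  have h2 := exp_moment_le E hE hS
  have h3 : (1 + (Real.exp θ - 1) * q) ^ N ≤ Real.exp (((Real.exp θ - 1) * q) * N) := by
    rw [mul_comm _ (N : ℝ), Real.exp_nat_mul]
    refine pow_le_pow_left₀ ?_ ?_ _
    · nlinarith [Real.exp_pos θ]
    · rw [add_comm]; exact Real.add_one_le_exp _
  have h4 : (Real.exp θ - 1) * q - θ * q ≤ (η / 2) ^ 2 := by
    have h5 := Real.abs_exp_sub_one_sub_id_le (x := θ) (by rw [hη]; linarith)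
    have h6 := (le_abs_self _).trans h5
    rw [← hsq]
    nlinarith [sq_nonneg θ]
  rw [map_smul, smul_eq_mul] at h1
  calc _ ≤ _ := h1
    _ ≤ Real.exp (-(θ * q * N) - |θ| * η * N) * Real.exp (((Real.exp θ - 1) * q) * N) :=
        mul_le_mul_of_nonneg_left (h2.trans h3) (Real.exp_pos _).le
    _ ≤ _ := by
        rw [← Real.exp_add, Real.exp_le_exp, hη]
        have hN : (0 : ℝ) ≤ N := Nat.cast_nonneg _
        nlinarith [mul_le_mul_of_nonneg_right h4 hN]

open scoped Classical in
lemma upper_deviation_le {n : ℕ} (E : (Config n → ℝ) →ₗ[ℝ] ℝ)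
    (hmono : ∀ f g : Config n → ℝ, (∀ x, f x ≤ g x) → E f ≤ E g) {r η : ℝ}
    (hr0 : 0 ≤ r) (hr1 : r ≤ 1) (hη : 0 < η) (hη2 : η ≤ 2)
    (hE : ∀ A : Finset (EdgeSet n), E (allOpen A) ≤ r ^ A.card)
    {F S : Finset (Fin n)} (hS : S ⊆ F) :
    E (fun x => if (r ^ S.card + η) * ((n - F.card : ℕ) : ℝ) ≤ common x F S then 1 else 0)
      ≤ Real.exp (-(η ^ 2 / 4 * ((n - F.card : ℕ) : ℝ))) := by
  have hθ : |η / 2| = η / 2 := abs_of_pos (by positivity)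
  have h := deviation_le E hmono (θ := η / 2) hr0 hr1 hθ hη2 (fun A j =>
    mul_le_mul_of_nonneg_left (hE A) (pow_nonneg (by
      linarith [Real.add_one_le_exp (η / 2)]) _)) hS
  refine (hmono _ _ fun x => ?_).trans h
  split_ifs with h1 h2 <;> norm_num
  refine h2 ?_
  rw [hθ]
  nlinarith

open scoped Classical in
lemma lower_deviation_le {n : ℕ} (E : (Config n → ℝ) →ₗ[ℝ] ℝ)
    (hmono : ∀ f g : Config n → ℝ, (∀ x, f x ≤ g x) → E f ≤ E g) {r η : ℝ}
    (hr0 : 0 ≤ r) (hr1 : r ≤ 1) (hη : 0 < η) (hη2 : η ≤ 2)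
    (hE : ∀ A : Finset (EdgeSet n), E (allOpen A) = r ^ A.card)
    {F S : Finset (Fin n)} (hS : S ⊆ F) :
    E (fun x => if (common x F S : ℝ) ≤ (r ^ S.card - η) * ((n - F.card : ℕ) : ℝ) then 1 else 0)
      ≤ Real.exp (-(η ^ 2 / 4 * ((n - F.card : ℕ) : ℝ))) := by
  have hθ : |-(η / 2)| = η / 2 := by rw [abs_neg]; exact abs_of_pos (by positivity)
  have h := deviation_le E hmono (θ := -(η / 2)) hr0 hr1 hθ hη2 (fun A j => by rw [hE]) hS
  refine (hmono _ _ fun x => ?_).trans h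
  split_ifs with h1 h2 <;> norm_num
  refine h2 ?_
  rw [hθ]
  nlinarith

/-- The dynamics in which every edge is independently refreshed with density `ρ`. -/
noncomputable def refresh (n : ℕ) (ρ : ℝ) : Module.End ℝ (Config n → ℝ) :=
  avg (seed n) (thStep fun _ _ => ρ)

lemma allOpen_update_of_notMem {n : ℕ} {A : Finset (EdgeSet n)} {e : EdgeSet n} (he : e ∉ A)
    (x : Config n) (b : Bool) : allOpen A (Function.update x e b) = allOpen A x := by
  refine prod_congr rfl fun f hf => ?_
  rw [Function.update_of_ne]
  exact fun h => he (h ▸ hf)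

lemma allOpen_update_of_mem {n : ℕ} {A : Finset (EdgeSet n)} {e : EdgeSet n} (he : e ∈ A)
    (x : Config n) (b : Bool) :
    allOpen A (Function.update x e b) = if b = true then allOpen (A.erase e) x else 0 := by
  rw [← allOpen_update_of_notMem (notMem_erase e A) x b, allOpen,
    ← mul_prod_erase A _ he, Function.update_self]
  cases b <;> simp [allOpen]

lemma refresh_allOpen {n : ℕ} (hn : 2 ≤ n) {ρ : ℝ} (h0 : 0 ≤ ρ) (h1 : ρ ≤ 1)
    (A : Finset (EdgeSet n)) :
    refresh n ρ (allOpen A) = (1 - A.card / (Fintype.card (EdgeSet n) : ℝ)) • allOpen A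
      + (ρ / Fintype.card (EdgeSet n)) • ∑ e ∈ A, allOpen (A.erase e) := by
  have := nonempty_edgeSet hn
  have hM : (Fintype.card (EdgeSet n) : ℝ) ≠ 0 := Nat.cast_ne_zero.2 Fintype.card_ne_zero
  ext x
  rw [refresh, avg_thStep hn (fun _ _ => h0) (fun _ _ => h1)]
  have h : ∀ e, ρ * allOpen A (Function.update x e true)
      + (1 - ρ) * allOpen A (Function.update x e false)
      = allOpen A x + if e ∈ A then ρ * allOpen (A.erase e) x - allOpen A x else 0 := by
    intro e
    split_ifs with he
    · rw [allOpen_update_of_mem he, allOpen_update_of_mem he]; simp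
    · rw [allOpen_update_of_notMem he, allOpen_update_of_notMem he]; ring
  simp only [h, sum_add_distrib, sum_const, card_univ, nsmul_eq_mul, sum_ite_mem, univ_inter,
    sum_sub_distrib, ← mul_sum, Pi.add_apply, Pi.smul_apply, smul_eq_mul, Finset.sum_apply]
  field_simp
  ring

/-- The product measure of density `ρ`, as a functional. -/
noncomputable def bernoulli (n : ℕ) (ρ : ℝ) : (Config n → ℝ) →ₗ[ℝ] ℝ :=
  ∑ y : Config n, (∏ e, if y e = true then ρ else 1 - ρ) • LinearMap.proj y

lemma bernoulli_apply {n : ℕ} (ρ : ℝ) (f : Config n → ℝ) :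
    bernoulli n ρ f = ∑ y : Config n, (∏ e, if y e = true then ρ else 1 - ρ) * f y := by
  simp [bernoulli]

lemma bernoulli_mono {n : ℕ} {ρ : ℝ} (h0 : 0 ≤ ρ) (h1 : ρ ≤ 1) (f g : Config n → ℝ)
    (h : ∀ x, f x ≤ g x) : bernoulli n ρ f ≤ bernoulli n ρ g := by
  rw [bernoulli_apply, bernoulli_apply]
  refine sum_le_sum fun y _ => mul_le_mul_of_nonneg_left (h y) (prod_nonneg fun e _ => ?_)
  split_ifs <;> linarith

lemma bernoulli_allOpen {n : ℕ} (ρ : ℝ) (A : Finset (EdgeSet n)) :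
    bernoulli n ρ (allOpen A) = ρ ^ A.card := by
  classical
  have h : ∀ y : Config n, (∏ e, if y e = true then ρ else 1 - ρ) * allOpen A y
      = ∏ e, (fun e b => if b = true then ρ else if e ∈ A then 0 else 1 - ρ) e (y e) := by
    intro y
    rw [allOpen, ← prod_filter_mul_prod_filter_not univ (fun e => e ∈ A) (fun e =>
      if y e = true then ρ else 1 - ρ),
      ← prod_filter_mul_prod_filter_not univ (fun e => e ∈ A) (fun e => _), mul_right_comm]
    have : univ.filter (fun e => e ∈ A) = A := by ext; simp
    rw [this, ← prod_mul_distrib]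
    congr 1
    · refine prod_congr rfl fun e he => ?_
      by_cases hy : y e = true <;> simp [hy, he]
    · refine prod_congr rfl fun e he => ?_
      rw [mem_filter] at he
      simp [he.2]
  rw [bernoulli_apply]
  simp only [h]
  rw [← Fintype.prod_sum fun (e : EdgeSet n) (b : Bool) =>
    if b = true then ρ else if e ∈ A then 0 else 1 - ρ, ← prod_const]
  have h2 : ∀ e : EdgeSet n, (∑ b : Bool, if b = true then ρ else if e ∈ A then 0 else 1 - ρ)
      = if e ∈ A then ρ else 1 := by
    intro e
    rw [Fintype.sum_bool]
    split_ifs <;> simp_all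
  rw [prod_congr rfl fun e _ => h2 e, prod_ite_mem, univ_inter]

lemma bernoulli_refresh_pow_allOpen {n : ℕ} (hn : 2 ≤ n) {ρ : ℝ} (h0 : 0 ≤ ρ) (h1 : ρ ≤ 1)
    (t : ℕ) (A : Finset (EdgeSet n)) :
    bernoulli n ρ ((refresh n ρ ^ t) (allOpen A)) = ρ ^ A.card := by
  induction t generalizing A with
  | zero => simpa using bernoulli_allOpen ρ A
  | succ t ih =>
    rw [pow_succ, Module.End.mul_apply, refresh_allOpen hn h0 h1, map_add, map_smul, map_smul,
      map_sum, map_add, map_smul, map_smul, map_sum, ih, sum_congr rfl fun e _ => ih _]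
    rw [sum_congr rfl fun e he => by rw [card_erase_of_mem he], sum_const, nsmul_eq_mul]
    rcases Nat.eq_zero_or_pos A.card with h | h
    · simp [h]
    · obtain ⟨k, hk⟩ := Nat.exists_eq_succ_of_ne_zero h.ne'
      rw [hk]
      simp only [smul_eq_mul, Nat.succ_eq_add_one, Nat.add_sub_cancel]
      ring

lemma refresh_zero_pow_allOpen {n : ℕ} (hn : 2 ≤ n) (t : ℕ) (A : Finset (EdgeSet n)) :
    (refresh n 0 ^ t) (allOpen A) (fun _ => true)
      = (1 - A.card / (Fintype.card (EdgeSet n) : ℝ)) ^ t := by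
  have h : (refresh n 0 ^ t) (allOpen A)
      = (1 - A.card / (Fintype.card (EdgeSet n) : ℝ)) ^ t • allOpen A := by
    induction t with
    | zero => simp
    | succ t ih =>
      rw [pow_succ, Module.End.mul_apply, refresh_allOpen hn le_rfl zero_le_one, zero_div,
        zero_smul, add_zero, map_smul, ih, smul_smul, pow_succ']
  rw [h]
  simp [allOpen]

lemma refresh_zero_pow_le {n : ℕ} (hn : 2 ≤ n) (K : ℕ) (A : Finset (EdgeSet n)) :
    (refresh n 0 ^ (K * n ^ 2)) (allOpen A) (fun _ => true) ≤ Real.exp (-K) ^ A.card := by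
  have := nonempty_edgeSet hn
  have hM : (0 : ℝ) < Fintype.card (EdgeSet n) := Nat.cast_pos.2 Fintype.card_pos
  rw [refresh_zero_pow_allOpen hn]
  have h1 : (0 : ℝ) ≤ 1 - A.card / (Fintype.card (EdgeSet n) : ℝ) := by
    rw [sub_nonneg, div_le_one hM]
    exact_mod_cast card_le_univ A
  have h2 : 1 - A.card / (Fintype.card (EdgeSet n) : ℝ)
      ≤ Real.exp (-(A.card / (Fintype.card (EdgeSet n) : ℝ))) := by
    linarith [Real.add_one_le_exp (-(A.card / (Fintype.card (EdgeSet n) : ℝ)))]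
  refine (pow_le_pow_left₀ h1 h2 _).trans ?_
  rw [← Real.exp_nat_mul, ← Real.exp_nat_mul, Real.exp_le_exp]
  have h3 := two_mul_card_edgeSet n
  have h4 : (1 : ℝ) ≤ n ^ 2 / Fintype.card (EdgeSet n) := by
    rw [le_div_iff₀ hM]
    nlinarith
  push_cast
  have h5 : (0 : ℝ) ≤ A.card * K := by positivity
  calc (K * (n : ℝ) ^ 2) * -(A.card / (Fintype.card (EdgeSet n) : ℝ))
      = -(A.card * K * (n ^ 2 / Fintype.card (EdgeSet n))) := by ring
    _ ≤ _ := by nlinarith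

lemma common_le_card {n : ℕ} (x : Config n) (F S : Finset (Fin n)) :
    (common x F S : ℝ) ≤ (n : ℝ) - F.card := by
  have h1 : common x F S ≤ Fᶜ.card := card_filter_le _ _
  have h2 : (Fᶜ.card : ℝ) = n - F.card := by
    rw [card_compl, Fintype.card_fin, Nat.cast_sub (card_finset_fin_le F)]
  rw [← h2]
  exact_mod_cast h1

lemma common_empty {n : ℕ} (x : Config n) (F : Finset (Fin n)) :
    (common x F ∅ : ℝ) = (n : ℝ) - F.card := by
  rw [common, filter_true_of_mem (by simp), card_compl, Fintype.card_fin,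
    Nat.cast_sub (card_finset_fin_le F)]

lemma upperRegular_one {n : ℕ} (L : ℕ) (x : Config n) : UpperRegular L 1 x := by
  intro F S _ _
  rw [one_pow, mul_one]
  exact common_le_card x F S

lemma lowerRegular_zero {n : ℕ} (L : ℕ) (x : Config n) : LowerRegular L 0 x := by
  intro F S _ _
  rcases S.eq_empty_or_nonempty with rfl | hS
  · rw [common_empty, card_empty, pow_zero, mul_one]
  · rw [zero_pow (card_pos.2 hS).ne', mul_zero]
    exact Nat.cast_nonneg _

/-- `x` and `y` satisfy `x ≤ y` away from the pairs that are open in `ν`. -/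
def LeOff {n : ℕ} (ν x y : Config n) : Prop := ∀ e, ν e = true ∨ (x e = true → y e = true)

lemma LeOff.common_le {n : ℕ} {ν x y : Config n} (h : LeOff ν x y) (F S : Finset (Fin n)) :
    common x F S ≤ common y F S + ∑ s ∈ S, common ν F {s} := by
  classical
  refine le_trans (card_le_card (t := (Fᶜ.filter fun w => ∀ s ∈ S, pairVal y s(w, s) = true) ∪
    S.biUnion fun s => Fᶜ.filter fun w => ∀ r ∈ ({s} : Finset (Fin n)), pairVal ν s(w, r) = true)
    ?_) ((card_union_le _ _).trans (Nat.add_le_add_left card_biUnion_le _))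
  intro w hw
  rw [mem_filter] at hw
  simp only [mem_union, mem_filter, mem_biUnion, mem_singleton, forall_eq]
  by_cases hν : ∃ s ∈ S, pairVal ν s(w, s) = true
  · obtain ⟨s, hs, h'⟩ := hν
    exact Or.inr ⟨s, hs, hw.1, h'⟩
  · push Not at hν
    refine Or.inl ⟨hw.1, fun s hs => ?_⟩
    have h1 := hw.2 s hs
    have h2 := hν s hs
    unfold pairVal at h1 h2 ⊢
    split_ifs at h1 h2 ⊢ with hd
    exact (h ⟨_, hd⟩).resolve_left h2 h1

/-- One step of the dynamics preserves `LeOff` when the thresholds are ordered. -/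
lemma LeOff.thStep {n : ℕ} {ν x y : Config n} (h : LeOff ν x y)
    {τ₀ τ₁ τ₂ : EdgeSet n → Config n → ℝ} (ω : EdgeSet n × ℝ) (hτ : τ₁ ω.1 x ≤ τ₂ ω.1 y) :
    LeOff (thStep τ₀ ω ν) (ERGM.thStep τ₁ ω x) (ERGM.thStep τ₂ ω y) := by
  intro e
  by_cases he : e = ω.1
  · subst he
    right
    simp only [ERGM.thStep, Function.update_self, decide_eq_true_eq]
    exact fun h' => h'.trans hτ
  · simp only [ERGM.thStep, Function.update_of_ne he]
    exact h e

open scoped Classical in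
/-- The indicator that `x` fails to be regular. -/
noncomputable def irregular {n : ℕ} (L : ℕ) (a b : ℝ) (x : Config n) : ℝ :=
  if UpperRegular L b x ∧ LowerRegular L a x then 0 else 1

lemma irregular_nonneg {n : ℕ} (L : ℕ) (a b : ℝ) (x : Config n) : 0 ≤ irregular L a b x := by
  unfold irregular; split_ifs <;> norm_num

open scoped Classical in
/-- The pairs of vertex sets that are tested in the definition of regularity. -/
noncomputable def testPairs (n L : ℕ) : Finset (Finset (Fin n) × Finset (Fin n)) :=
  univ.filter fun q => q.1.card ≤ L ∧ q.2 ⊆ q.1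

lemma card_testPairs_le {n : ℕ} (hn : 0 < n) (L : ℕ) :
    (testPairs n L).card ≤ ((L + 1) * n ^ L) ^ 2 := by
  classical
  have h1 : (univ.filter fun F : Finset (Fin n) => F.card ≤ L).card ≤ (L + 1) * n ^ L := by
    have h2 : (univ.filter fun F : Finset (Fin n) => F.card ≤ L)
        ⊆ (range (L + 1)).biUnion fun j => powersetCard j univ := by
      intro F hF
      rw [mem_filter] at hF
      exact mem_biUnion.2 ⟨F.card, mem_range.2 (Nat.lt_succ_of_le hF.2),
        mem_powersetCard.2 ⟨subset_univ _, rfl⟩⟩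
    refine (card_le_card h2).trans (card_biUnion_le.trans ?_)
    have h3 : ∀ j ∈ range (L + 1), (powersetCard j (univ : Finset (Fin n))).card ≤ n ^ L := by
      intro j hj
      rw [card_powersetCard, card_univ, Fintype.card_fin]
      exact (Nat.choose_le_pow n j).trans
        (Nat.pow_le_pow_right hn (Nat.lt_succ_iff.1 (mem_range.1 hj)))
    simpa using sum_le_card_nsmul _ _ _ h3
  have h4 : testPairs n L ⊆ (univ.filter fun F : Finset (Fin n) => F.card ≤ L) ×ˢ
      (univ.filter fun F : Finset (Fin n) => F.card ≤ L) := by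
    rintro ⟨F, S⟩ h
    simp only [testPairs, mem_filter, mem_univ, true_and] at h
    simp only [mem_product, mem_filter, mem_univ, true_and]
    exact ⟨h.1, (card_le_card h.2).trans h.1⟩
  refine (card_le_card h4).trans ?_
  rw [card_product, sq]
  exact Nat.mul_le_mul h1 h1

open scoped Classical in
/-- The indicator of an upper deviation of a common neighbour count from density `r`. -/
noncomputable def tooMany {n : ℕ} (r η : ℝ) (q : Finset (Fin n) × Finset (Fin n))
    (x : Config n) : ℝ :=
  if (r ^ q.2.card + η) * ((n - q.1.card : ℕ) : ℝ) ≤ common x q.1 q.2 then 1 else 0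

open scoped Classical in
/-- The indicator of a lower deviation of a common neighbour count from density `r`. -/
noncomputable def tooFew {n : ℕ} (r η : ℝ) (q : Finset (Fin n) × Finset (Fin n))
    (x : Config n) : ℝ :=
  if (common x q.1 q.2 : ℝ) ≤ (r ^ q.2.card - η) * ((n - q.1.card : ℕ) : ℝ) then 1 else 0

lemma tooMany_nonneg {n : ℕ} (r η : ℝ) (q : Finset (Fin n) × Finset (Fin n)) (x : Config n) :
    0 ≤ tooMany r η q x := by
  unfold tooMany; split_ifs <;> norm_num

lemma tooFew_nonneg {n : ℕ} (r η : ℝ) (q : Finset (Fin n) × Finset (Fin n)) (x : Config n) :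
    0 ≤ tooFew r η q x := by
  unfold tooFew; split_ifs <;> norm_num

/-- A configuration sandwiched between regular ones is regular, up to the pairs open in `ν`. -/
lemma irregular_le_of_leOff {n L : ℕ} {a b ρ₀ ρ₁ κ η : ℝ} (hκ : κ ≤ η)
    (hb : ∀ k ∈ Icc 1 L, ρ₁ ^ k + (2 * L + 1) * η ≤ b ^ k)
    (ha : ∀ k ∈ Icc 1 L, a ^ k + (2 * L + 1) * η ≤ ρ₀ ^ k)
    {ν z y₀ y₁ : Config n} (h₀ : LeOff ν y₀ z) (h₁ : LeOff ν z y₁) :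
    irregular L a b z ≤ ∑ q ∈ testPairs n L,
      (tooMany ρ₁ η q y₁ + tooFew ρ₀ η q y₀ + tooMany κ η q ν) := by
  have hnn : ∀ q ∈ testPairs n L,
      0 ≤ tooMany ρ₁ η q y₁ + tooFew ρ₀ η q y₀ + tooMany κ η q ν := fun q _ =>
    add_nonneg (add_nonneg (tooMany_nonneg _ _ _ _) (tooFew_nonneg _ _ _ _))
      (tooMany_nonneg _ _ _ _)
  by_cases hgood : ∀ q ∈ testPairs n L,
      tooMany ρ₁ η q y₁ + tooFew ρ₀ η q y₀ + tooMany κ η q ν = 0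
  · have hz : ∀ q ∈ testPairs n L,
        tooMany ρ₁ η q y₁ = 0 ∧ tooFew ρ₀ η q y₀ = 0 ∧ tooMany κ η q ν = 0 := by
      intro q hq
      have := hgood q hq
      have h1 := tooMany_nonneg ρ₁ η q y₁
      have h2 := tooFew_nonneg ρ₀ η q y₀
      have h3 := tooMany_nonneg κ η q ν
      exact ⟨by linarith, by linarith, by linarith⟩
    have hreg : UpperRegular L b z ∧ LowerRegular L a z := by
      refine forall_and.1 fun F => forall_and.1 fun S => ?_
      refine forall_and.1 fun hF => forall_and.1 fun hS => ?_
      rcases S.eq_empty_or_nonempty with rfl | hSne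
      · simp [common_empty]
      have hk : S.card ∈ Icc 1 L := mem_Icc.2 ⟨card_pos.2 hSne, (card_le_card hS).trans hF⟩
      have hcast : ((n - F.card : ℕ) : ℝ) = (n : ℝ) - F.card :=
        Nat.cast_sub (card_finset_fin_le F)
      have hN : (0 : ℝ) ≤ (n : ℝ) - F.card := hcast ▸ Nat.cast_nonneg _
      have hFS := hz (F, S) (by simp [testPairs, hF, hS])
      simp only [tooMany, tooFew, ite_eq_right_iff, one_ne_zero, imp_false, not_le, hcast]
        at hFS
      have hν : ∀ s ∈ S, (common ν F {s} : ℝ) ≤ 2 * η * ((n : ℝ) - F.card) := by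
        intro s hs
        have := (hz (F, {s}) (by simp [testPairs, hF, hS hs])).2.2
        simp only [tooMany, ite_eq_right_iff, one_ne_zero, imp_false, not_le, hcast,
          card_singleton, pow_one] at this
        nlinarith
      have hsum : ∑ s ∈ S, (common ν F {s} : ℝ) ≤ L * (2 * η * ((n : ℝ) - F.card)) := by
        refine (sum_le_sum hν).trans ?_
        rw [sum_const, nsmul_eq_mul]
        have h0 : 0 ≤ 2 * η * ((n : ℝ) - F.card) := by
          obtain ⟨s, hs⟩ := hSne
          exact (Nat.cast_nonneg _).trans (hν s hs)
        exact mul_le_mul_of_nonneg_right (by exact_mod_cast (mem_Icc.1 hk).2) h0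
      have hz1 : (common z F S : ℝ) ≤ common y₁ F S + ∑ s ∈ S, (common ν F {s} : ℝ) := by
        exact_mod_cast h₁.common_le F S
      have hz2 : (common y₀ F S : ℝ) ≤ common z F S + ∑ s ∈ S, (common ν F {s} : ℝ) := by
        exact_mod_cast h₀.common_le F S
      have hb' := mul_le_mul_of_nonneg_right (hb _ hk) hN
      have ha' := mul_le_mul_of_nonneg_right (ha _ hk) hN
      exact ⟨by linarith [hFS.1], by linarith [hFS.2.1]⟩
    rw [irregular, if_pos hreg]
    exact sum_nonneg hnn
  · push Not at hgood
    obtain ⟨q, hq, hne⟩ := hgood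
    have h1 : irregular L a b z ≤ 1 := by unfold irregular; split_ifs <;> norm_num
    refine h1.trans (le_trans ?_ (single_le_sum hnn hq))
    by_contra hlt
    push Not at hlt
    apply hne
    unfold tooMany tooFew at hlt ⊢
    split_ifs at hlt ⊢ <;> first | (norm_num; done) | norm_num at hlt

lemma avg_le_of_forall_le {Ω α : Type*} [MeasurableSpace Ω] [Fintype α] [MeasurableSpace α]
    [MeasurableSingletonClass α] (μ : Measure Ω) [IsProbabilityMeasure μ] {step : Ω → α → α}
    (hstep : ∀ a, Measurable fun ω => step ω a) {f : α → ℝ} {a : α} {c : ℝ}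
    (h : ∀ ω, f (step ω a) ≤ c) : avg μ step f a ≤ c := by
  rw [avg_apply μ hstep]
  refine (integral_mono (integrable_comp_of_fintype μ f (hstep a)) (integrable_const c) h).trans ?_
  simp

lemma avg_pow_le_add_sum {Ω α : Type*} [MeasurableSpace Ω] [Fintype α] (μ : Measure Ω)
    {step : Ω → α → α} {f g : α → ℝ} (h : ∀ a, avg μ step f a ≤ f a + g a) (t : ℕ) (a : α) :
    (avg μ step ^ t) f a ≤ f a + ∑ i ∈ range t, (avg μ step ^ i) g a := by
  induction t with
  | zero => simp
  | succ t ih =>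
    rw [pow_succ, Module.End.mul_apply, sum_range_succ]
    have h1 := avg_pow_mono μ step (g := f + g) h t a
    rw [map_add, Pi.add_apply] at h1
    linarith

lemma le_bernoulli {n : ℕ} {ρ : ℝ} (h0 : 0 ≤ ρ) (h1 : ρ ≤ 1) {f : Config n → ℝ} {c : ℝ}
    (h : ∀ y, c ≤ f y) : c ≤ bernoulli n ρ f := by
  have h2 := bernoulli_mono h0 h1 (c • allOpen ∅) f (fun y => by simpa [allOpen] using h y)
  rwa [map_smul, bernoulli_allOpen, card_empty, pow_zero, smul_eq_mul, mul_one] at h2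

lemma avg_pow_lincomb {Ω α ι : Type*} [MeasurableSpace Ω] [Fintype α] (μ : Measure Ω)
    (step : Ω → α → α) (s : Finset ι) (f : ι → α → ℝ) (t : ℕ) (a : α) :
    (avg μ step ^ t) (fun b => ∑ i ∈ s, f i b) a = ∑ i ∈ s, (avg μ step ^ t) (f i) a := by
  have : (fun b => ∑ i ∈ s, f i b) = ∑ i ∈ s, f i := by ext b; rw [Finset.sum_apply]
  rw [this, map_sum, Finset.sum_apply]

lemma window_le_pointwise {n L : ℕ} (hn : 2 ≤ n) {τ : EdgeSet n → Config n → ℝ}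
    {a b a' b' ρ₀ ρ₁ η : ℝ}
    (hτ : ∀ x, UpperRegular L b x → LowerRegular L a x → ∀ e, ρ₀ ≤ τ e x ∧ τ e x ≤ ρ₁)
    {κ : ℝ} (hκ : κ ≤ η)
    (hb : ∀ k ∈ Icc 1 L, ρ₁ ^ k + (2 * L + 1) * η ≤ b' ^ k)
    (ha : ∀ k ∈ Icc 1 L, a' ^ k + (2 * L + 1) * η ≤ ρ₀ ^ k) (W : ℕ) (z y₀ y₁ : Config n) :
    (avg (seed n) (thStep τ) ^ W) (irregular L a' b') z
      ≤ (∑ i ∈ range W, (avg (seed n) (thStep τ) ^ i) (irregular L a b) z)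
        + ∑ q ∈ testPairs n L, ((refresh n ρ₁ ^ W) (tooMany ρ₁ η q) y₁
          + (refresh n ρ₀ ^ W) (tooFew ρ₀ η q) y₀
          + (refresh n 0 ^ W) (tooMany κ η q) fun _ => true) := by
  classical
  have := isProbabilityMeasure_seed hn
  let T : Fin 4 → EdgeSet n → Config n → ℝ := ![τ, fun _ _ => ρ₀, fun _ _ => ρ₁, fun _ _ => 0]
  let σ₀ : Fin 4 → Config n := ![z, y₀, y₁, fun _ => true]
  let J := avg (seed n) (jointStep T)
  let D : (Fin 4 → Config n) → ℝ := fun σ =>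
    if LeOff (σ 3) (σ 1) (σ 0) ∧ LeOff (σ 3) (σ 0) (σ 2) then 0 else 1
  have hD : ∀ σ, J D σ ≤ D σ + irregular L a b (σ 0) := by
    intro σ
    refine avg_le_of_forall_le _ (measurable_jointStep T) fun ω => ?_
    by_cases hs : LeOff (σ 3) (σ 1) (σ 0) ∧ LeOff (σ 3) (σ 0) (σ 2)
    · by_cases hr : UpperRegular L b (σ 0) ∧ LowerRegular L a (σ 0)
      · have h1 : LeOff (jointStep T ω σ 3) (jointStep T ω σ 1) (jointStep T ω σ 0) :=
          hs.1.thStep ω (hτ _ hr.1 hr.2 _).1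
        have h2 : LeOff (jointStep T ω σ 3) (jointStep T ω σ 0) (jointStep T ω σ 2) :=
          hs.2.thStep ω (hτ _ hr.1 hr.2 _).2
        simp only [D, irregular, if_pos hs, if_pos hr, if_pos (And.intro h1 h2), add_zero, le_refl]
      · simp only [D, irregular, if_pos hs, if_neg hr, zero_add]
        split_ifs <;> norm_num
    · have := irregular_nonneg L a b (σ 0)
      have h1 : D σ = 1 := if_neg hs
      have h2 : D (jointStep T ω σ) ≤ 1 := by simp only [D]; split_ifs <;> norm_num
      linarith
  have hD0 : D σ₀ = 0 := if_pos ⟨fun _ => Or.inl rfl, fun _ => Or.inl rfl⟩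
  let R : (Fin 4 → Config n) → ℝ := fun σ => ∑ q ∈ testPairs n L,
    (tooMany ρ₁ η q (σ 2) + tooFew ρ₀ η q (σ 1) + tooMany κ η q (σ 3))
  have hR : ∀ σ, irregular L a' b' (σ 0) ≤ D σ + R σ := by
    intro σ
    by_cases hs : LeOff (σ 3) (σ 1) (σ 0) ∧ LeOff (σ 3) (σ 0) (σ 2)
    · simp only [D, if_pos hs, zero_add]
      exact irregular_le_of_leOff hκ hb ha hs.1 hs.2
    · have h1 : irregular L a' b' (σ 0) ≤ 1 := by unfold irregular; split_ifs <;> norm_num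
      have h2 : 0 ≤ R σ := sum_nonneg fun q _ =>
        add_nonneg (add_nonneg (tooMany_nonneg _ _ _ _) (tooFew_nonneg _ _ _ _))
          (tooMany_nonneg _ _ _ _)
      have h3 : D σ = 1 := if_neg hs
      linarith
  have h1 := avg_pow_mono (seed n) (jointStep T) hR W σ₀
  have h2 := avg_pow_le_add_sum (seed n) hD W σ₀
  rw [hD0, zero_add] at h2
  have h3 : (J ^ W) (fun σ => D σ + R σ) σ₀ = (J ^ W) D σ₀ + (J ^ W) R σ₀ := by
    rw [← Pi.add_apply ((J ^ W) D), ← map_add]; rfl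
  have h4 : (J ^ W) R σ₀ = ∑ q ∈ testPairs n L, ((refresh n ρ₁ ^ W) (tooMany ρ₁ η q) y₁
      + (refresh n ρ₀ ^ W) (tooFew ρ₀ η q) y₀
      + (refresh n 0 ^ W) (tooMany κ η q) fun _ => true) := by
    rw [avg_pow_lincomb]
    refine sum_congr rfl fun q _ => ?_
    have h5 : (fun σ : Fin 4 → Config n =>
        tooMany ρ₁ η q (σ 2) + tooFew ρ₀ η q (σ 1) + tooMany κ η q (σ 3))
        = (fun σ => tooMany ρ₁ η q (σ 2)) + (fun σ => tooFew ρ₀ η q (σ 1))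
          + fun σ => tooMany κ η q (σ 3) := rfl
    rw [h5, map_add, map_add, Pi.add_apply, Pi.add_apply, avg_jointStep_pow hn T 2,
      avg_jointStep_pow hn T 1, avg_jointStep_pow hn T 3]
    rfl
  rw [avg_jointStep_pow hn T 0] at h1
  have h6 : ∀ i, (J ^ i) (fun σ => irregular L a b (σ 0)) σ₀
      = (avg (seed n) (thStep τ) ^ i) (irregular L a b) z := fun i =>
    avg_jointStep_pow hn T 0 _ i σ₀
  simp only [J] at h1 h2 h3 h4 h6
  rw [h3, h4] at h1
  rw [sum_congr rfl fun i _ => h6 i] at h2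
  exact h1.trans (add_le_add h2 le_rfl)

lemma refresh_pow_mono {n : ℕ} (ρ : ℝ) (t : ℕ) {f g : Config n → ℝ} (h : ∀ x, f x ≤ g x)
    (x : Config n) : (refresh n ρ ^ t) f x ≤ (refresh n ρ ^ t) g x :=
  avg_pow_mono _ _ h t x

lemma window_le {n L K : ℕ} (hn : 2 ≤ n) {τ : EdgeSet n → Config n → ℝ}
    {a b a' b' ρ₀ ρ₁ η : ℝ} (h0 : 0 ≤ ρ₀) (h0' : ρ₀ ≤ 1) (h1 : 0 ≤ ρ₁) (h1' : ρ₁ ≤ 1)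
    (hη : 0 < η) (hη2 : η ≤ 2)
    (hτ : ∀ x, UpperRegular L b x → LowerRegular L a x → ∀ e, ρ₀ ≤ τ e x ∧ τ e x ≤ ρ₁)
    (hK : Real.exp (-K) ≤ η)
    (hb : ∀ k ∈ Icc 1 L, ρ₁ ^ k + (2 * L + 1) * η ≤ b' ^ k)
    (ha : ∀ k ∈ Icc 1 L, a' ^ k + (2 * L + 1) * η ≤ ρ₀ ^ k) (z : Config n) :
    (avg (seed n) (thStep τ) ^ (K * n ^ 2)) (irregular L a' b') z
      ≤ (∑ i ∈ range (K * n ^ 2), (avg (seed n) (thStep τ) ^ i) (irregular L a b) z)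
        + (testPairs n L).card * (3 * Real.exp (-(η ^ 2 / 4 * ((n : ℝ) - L)))) := by
  set W := K * n ^ 2
  set κ := Real.exp (-K)
  set A := (avg (seed n) (thStep τ) ^ W) (irregular L a' b') z
  set B := ∑ i ∈ range W, (avg (seed n) (thStep τ) ^ i) (irregular L a b) z
  set ε := Real.exp (-(η ^ 2 / 4 * ((n : ℝ) - L)))
  have hp := window_le_pointwise hn hτ hK hb ha W z
  have hε : ∀ q ∈ testPairs n L, q.2 ⊆ q.1 ∧
      Real.exp (-(η ^ 2 / 4 * ((n - q.1.card : ℕ) : ℝ))) ≤ ε := by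
    intro q hq
    simp only [testPairs, mem_filter, mem_univ, true_and] at hq
    refine ⟨hq.2, Real.exp_le_exp.2 (neg_le_neg (mul_le_mul_of_nonneg_left ?_ (by positivity)))⟩
    rw [Nat.cast_sub (card_finset_fin_le q.1)]
    have : (q.1.card : ℝ) ≤ L := by exact_mod_cast hq.1
    linarith
  have hmany : ∀ q ∈ testPairs n L,
      bernoulli n ρ₁ ((refresh n ρ₁ ^ W) (tooMany ρ₁ η q)) ≤ ε := fun q hq =>
    (upper_deviation_le (bernoulli n ρ₁ ∘ₗ (refresh n ρ₁ ^ W))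
      (fun f g h => bernoulli_mono h1 h1' _ _ (refresh_pow_mono ρ₁ W h)) h1 h1' hη hη2
      (fun C => (bernoulli_refresh_pow_allOpen hn h1 h1' W C).le) (hε q hq).1).trans (hε q hq).2
  have hfew : ∀ q ∈ testPairs n L,
      bernoulli n ρ₀ ((refresh n ρ₀ ^ W) (tooFew ρ₀ η q)) ≤ ε := fun q hq =>
    (lower_deviation_le (bernoulli n ρ₀ ∘ₗ (refresh n ρ₀ ^ W))
      (fun f g h => bernoulli_mono h0 h0' _ _ (refresh_pow_mono ρ₀ W h)) h0 h0' hη hη2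
      (fun C => bernoulli_refresh_pow_allOpen hn h0 h0' W C) (hε q hq).1).trans (hε q hq).2
  have hzero : ∀ q ∈ testPairs n L,
      (refresh n 0 ^ W) (tooMany κ η q) (fun _ => true) ≤ ε := fun q hq =>
    (upper_deviation_le (LinearMap.proj (fun _ => true) ∘ₗ (refresh n 0 ^ W))
      (fun f g h => refresh_pow_mono 0 W h _) (Real.exp_pos _).le
      (Real.exp_le_one_iff.2 (neg_nonpos.2 (Nat.cast_nonneg _))) hη hη2
      (fun C => refresh_zero_pow_le hn K C) (hε q hq).1).trans (hε q hq).2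
  set U₁ : Config n → ℝ := ∑ q ∈ testPairs n L, (refresh n ρ₁ ^ W) (tooMany ρ₁ η q)
  set U₀ : Config n → ℝ := ∑ q ∈ testPairs n L, (refresh n ρ₀ ^ W) (tooFew ρ₀ η q)
  set U := ∑ q ∈ testPairs n L, (refresh n 0 ^ W) (tooMany κ η q) (fun _ => true)
  have hp' : ∀ y₀ y₁, A ≤ B + (U₁ y₁ + U₀ y₀ + U) := by
    intro y₀ y₁
    have := hp y₀ y₁
    rw [sum_add_distrib, sum_add_distrib] at this
    simpa only [U₁, U₀, U, Finset.sum_apply] using this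
  have hU : U ≤ (testPairs n L).card * ε := by
    rw [← nsmul_eq_mul]; exact sum_le_card_nsmul _ _ _ hzero
  have hU₁ : bernoulli n ρ₁ U₁ ≤ (testPairs n L).card * ε := by
    rw [map_sum, ← nsmul_eq_mul]; exact sum_le_card_nsmul _ _ _ hmany
  have hU₀ : bernoulli n ρ₀ U₀ ≤ (testPairs n L).card * ε := by
    rw [map_sum, ← nsmul_eq_mul]; exact sum_le_card_nsmul _ _ _ hfew
  have hq : ∀ y₀, A - B - U - U₀ y₀ ≤ bernoulli n ρ₁ U₁ := fun y₀ =>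
    le_bernoulli h1 h1' fun y₁ => by linarith [hp' y₀ y₁]
  have hr : A - B - U - bernoulli n ρ₁ U₁ ≤ bernoulli n ρ₀ U₀ :=
    le_bernoulli h0 h0' fun y₀ => by linarith [hq y₀]
  linarith

lemma Phi_pos (u : ℝ) : 0 < Phi u := by unfold Phi; positivity

lemma Phi_lt_one (u : ℝ) : Phi u < 1 := by
  unfold Phi
  rw [div_lt_one (by positivity)]
  linarith

lemma hasDerivAt_Phi (u : ℝ) :
    HasDerivAt Phi (Real.exp u / (1 + Real.exp u) ^ 2) u := by
  have h := (Real.hasDerivAt_exp u).div ((Real.hasDerivAt_exp u).const_add 1)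
    (by positivity)
  refine h.congr_deriv ?_
  ring

lemma continuous_Phi : Continuous Phi :=
  continuous_iff_continuousAt.2 fun u => (hasDerivAt_Phi u).continuousAt

lemma Phi_mono : Monotone Phi := by
  intro u v h
  unfold Phi
  rw [div_le_div_iff₀ (by positivity) (by positivity)]
  nlinarith [Real.exp_le_exp.2 h]

section Sub

variable {s : ℕ} (V : Fin s → ℕ) (G : ∀ i, SimpleGraph (Fin (V i))) (β : Fin s → ℝ)

lemma continuous_Psi : Continuous (Psi V G β) :=
  continuous_iff_continuousAt.2 fun q => (hasDerivAt_Psi V G β q).continuousAt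

lemma continuous_phiFn : Continuous (phiFn V G β) :=
  continuous_Phi.comp (continuous_Psi V G β)

variable {β}

lemma Psi_mono (hβ : ∀ i, 0 < β i) {q r : ℝ} (hq : 0 ≤ q) (h : q ≤ r) :
    Psi V G β q ≤ Psi V G β r := by
  refine sum_le_sum fun i _ => mul_le_mul_of_nonneg_left (pow_le_pow_left₀ hq h _) ?_
  have := (hβ i).le
  positivity

lemma phiFn_mono (hβ : ∀ i, 0 < β i) {q r : ℝ} (hq : 0 ≤ q) (h : q ≤ r) :
    phiFn V G β q ≤ phiFn V G β r := Phi_mono (Psi_mono V G hβ hq h)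

variable (β)

/-- The transition operator of the Glauber dynamics. -/
noncomputable def glauber (n : ℕ) : Module.End ℝ (Config n → ℝ) :=
  avg (seed n) (thStep fun e x => Phi (dHam V G β e x))

/-- After order `n ^ 2` steps the chain is regular, up to exponentially small probability. -/
def BurnIn (L : ℕ) (a b : ℝ) : Prop :=
  ∃ (C : ℕ) (α : ℝ), 0 < α ∧ ∀ᶠ n : ℕ in atTop, ∀ t : ℕ, C * n ^ 2 ≤ t → ∀ z : Config n,
    (glauber V G β n ^ t) (irregular L a b) z ≤ Real.exp (-α * n)

lemma burnIn_zero_one (L : ℕ) : BurnIn V G β L 0 1 := by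
  refine ⟨0, 1, one_pos, Eventually.of_forall fun n t _ z => ?_⟩
  have : irregular L 0 1 = (0 : Config n → ℝ) := by
    ext x
    exact if_pos ⟨upperRegular_one L x, lowerRegular_zero L x⟩
  rw [this, map_zero]
  exact (Real.exp_pos _).le

lemma tendsto_mul_pow_mul_exp (c : ℝ) (j : ℕ) {b : ℝ} (hb : 0 < b) :
    Tendsto (fun n : ℕ => c * ((n : ℝ) ^ j * Real.exp (-b * n))) atTop (nhds 0) := by
  have h := (tendsto_rpow_mul_exp_neg_mul_atTop_nhds_zero j b hb).comp
    tendsto_natCast_atTop_atTop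
  simpa using h.const_mul c

lemma eventually_mul_pow_mul_exp_le (c : ℝ) (j : ℕ) {b b' ε : ℝ} (hb : b' < b) (hε : 0 < ε) :
    ∀ᶠ n : ℕ in atTop, c * (n : ℝ) ^ j * Real.exp (-b * n) ≤ ε * Real.exp (-b' * n) := by
  filter_upwards [(tendsto_mul_pow_mul_exp c j (sub_pos.2 hb)).eventually_le_const hε] with n hn
  have : Real.exp (-b * n) = Real.exp (-(b - b') * n) * Real.exp (-b' * n) := by
    rw [← Real.exp_add]; ring_nf
  rw [this]
  nlinarith [Real.exp_pos (-b' * n)]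

lemma exists_gap (L : ℕ) {q r q' r' : ℝ} (hq : 0 ≤ q) (hr : q < r) (hq' : 0 ≤ q')
    (hr' : q' < r') : ∃ η : ℝ, 0 < η ∧ η ≤ 2 ∧
      (∀ k ∈ Icc 1 L, q ^ k + (2 * L + 1) * η ≤ r ^ k) ∧
      ∀ k ∈ Icc 1 L, q' ^ k + (2 * L + 1) * η ≤ r' ^ k := by
  have key : ∀ q r : ℝ, 0 ≤ q → q < r →
      ∀ᶠ η in nhds (0 : ℝ), ∀ k ∈ Icc 1 L, q ^ k + (2 * L + 1) * η ≤ r ^ k := by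
    intro q r hq hr
    rw [eventually_all_finset]
    intro k hk
    have h1 : Tendsto (fun η : ℝ => q ^ k + (2 * L + 1) * η) (nhds 0)
        (nhds (q ^ k + (2 * L + 1) * 0)) := by
      exact Continuous.tendsto (by fun_prop) 0
    refine h1.eventually_le_const ?_
    rw [mul_zero, add_zero]
    exact pow_lt_pow_left₀ hr hq (by have := (mem_Icc.1 hk).1; omega)
  have h2 : ∀ᶠ η in nhds (0 : ℝ), η ≤ 2 := eventually_le_nhds (by norm_num)
  have h3 := (((key q r hq hr).and (key q' r' hq' hr')).and h2).filter_mono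
    (nhdsWithin_le_nhds (s := Set.Ioi 0))
  obtain ⟨η, ⟨⟨h4, h5⟩, h6⟩, h7⟩ := (h3.and self_mem_nhdsWithin).exists
  exact ⟨η, h7, h6, h4, h5⟩

variable {V G β}

lemma BurnIn.step (hβ : ∀ i, 0 < β i) {L : ℕ} (hV : ∀ i, V i ≤ L) {a b a' b' : ℝ}
    (h : BurnIn V G β L a b) (ha : 0 ≤ a) (hb : 0 ≤ b) (ha0 : 0 ≤ a') (ha' : a' < phiFn V G β a)
    (hb' : phiFn V G β b < b') : BurnIn V G β L a' b' := by
  obtain ⟨C, α, hα, hC⟩ := h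
  obtain ⟨ρ, hρ, hρ'⟩ := exists_between ha'
  obtain ⟨η, hη, hη2, hgb, hga⟩ := exists_gap L (Phi_pos (Psi V G β b)).le hb' ha0 hρ
  obtain ⟨K, hK⟩ : ∃ K : ℕ, Real.exp (-K) ≤ η :=
    ((Real.tendsto_exp_neg_atTop_nhds_zero.comp tendsto_natCast_atTop_atTop).eventually_le_const
      hη).exists
  have hlim : Tendsto (fun n : ℕ => Phi ((1 - (L : ℝ) / n) ^ L * Psi V G β a)) atTop
      (nhds (phiFn V G β a)) := by
    refine (continuous_Phi.tendsto _).comp ?_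
    have h1 : Tendsto (fun n : ℕ => (1 - (L : ℝ) / n) ^ L * Psi V G β a) atTop
        (nhds ((1 - 0) ^ L * Psi V G β a)) :=
      ((tendsto_const_nhds.sub (tendsto_const_div_atTop_nhds_zero_nat (L : ℝ))).pow L).mul_const _
    simpa using h1
  set γ := min α (η ^ 2 / 4) / 2
  have hm : 0 < min α (η ^ 2 / 4) := lt_min hα (by positivity)
  have hγ : 0 < γ := half_pos hm
  have hγ1 : γ < α := (half_lt_self hm).trans_le (min_le_left _ _)
  have hγ2 : γ < η ^ 2 / 4 := (half_lt_self hm).trans_le (min_le_right _ _)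
  refine ⟨C + K, γ, hγ, ?_⟩
  filter_upwards [hC, hlim.eventually_const_le hρ', eventually_ge_atTop 2, eventually_ge_atTop L,
    eventually_mul_pow_mul_exp_le K 2 hγ1 one_half_pos,
    eventually_mul_pow_mul_exp_le (3 * (L + 1) ^ 2 * Real.exp (η ^ 2 / 4 * L)) (2 * L) hγ2
      one_half_pos] with n hCn hρn hn hLn he1 he2 t ht z
  have := isProbabilityMeasure_seed hn
  have hn0 : 0 < n := by omega
  have hτ : ∀ x : Config n, UpperRegular L b x → LowerRegular L a x → ∀ e,
      ρ ≤ Phi (dHam V G β e x) ∧ Phi (dHam V G β e x) ≤ phiFn V G β b := fun x hU hl e =>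
    ⟨hρn.trans (Phi_mono (Psi_le_dHam V G hβ hV ha x hl e hn0 hLn)),
      Phi_mono (dHam_le_Psi V G hβ hV hb x hU e hn0)⟩
  have hρ1 : ρ ≤ 1 := hρ'.le.trans (Phi_lt_one _).le
  have hw := window_le hn (ha0.trans hρ.le) hρ1 (Phi_pos _).le (Phi_lt_one _).le hη hη2 hτ hK
    hgb hga
  set T := t - K * n ^ 2
  have hT : C * n ^ 2 ≤ T := by
    rw [add_mul] at ht; omega
  have htT : t = T + K * n ^ 2 := by
    rw [add_mul] at ht
    have : K * n ^ 2 ≤ t := le_trans (Nat.le_add_left _ _) ht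
    omega
  set ε := (testPairs n L).card * (3 * Real.exp (-(η ^ 2 / 4 * ((n : ℝ) - L))))
  have h1 : (glauber V G β n ^ t) (irregular L a' b') z
      ≤ (∑ i ∈ range (K * n ^ 2), (glauber V G β n ^ (T + i)) (irregular L a b) z) + ε := by
    have h2 := avg_pow_mono (seed n) (thStep fun e x => Phi (dHam V G β e x)) hw T z
    rw [htT, pow_add]
    refine h2.trans (le_of_eq ?_)
    have h3 : (fun a_1 : Config n => (∑ i ∈ range (K * n ^ 2),
        (avg (seed n) (thStep fun e x => Phi (dHam V G β e x)) ^ i) (irregular L a b) a_1) + ε)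
        = (∑ i ∈ range (K * n ^ 2), (glauber V G β n ^ i) (irregular L a b)) + fun _ => ε := by
      ext x
      rw [Pi.add_apply, Finset.sum_apply]
      rfl
    rw [h3, map_add, map_sum, Pi.add_apply, Finset.sum_apply,
      avg_pow_const _ (measurable_thStep _)]
    simp only [pow_add]
    rfl
  have h4 : ∑ i ∈ range (K * n ^ 2), (glauber V G β n ^ (T + i)) (irregular L a b) z
      ≤ K * (n : ℝ) ^ 2 * Real.exp (-α * n) := by
    refine (sum_le_card_nsmul _ _ (Real.exp (-α * n))
      fun i _ => hCn (T + i) (hT.trans (Nat.le_add_right _ _)) z).trans (le_of_eq ?_)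
    rw [card_range, nsmul_eq_mul]
    push_cast
    ring
  have h5 : ε ≤ 3 * (L + 1) ^ 2 * Real.exp (η ^ 2 / 4 * L) * (n : ℝ) ^ (2 * L)
      * Real.exp (-(η ^ 2 / 4) * n) := by
    have h6 : ((testPairs n L).card : ℝ) ≤ ((L + 1) * (n : ℝ) ^ L) ^ 2 := by
      exact_mod_cast card_testPairs_le hn0 L
    have h7 : Real.exp (-(η ^ 2 / 4 * ((n : ℝ) - L)))
        = Real.exp (η ^ 2 / 4 * L) * Real.exp (-(η ^ 2 / 4) * n) := by
      rw [← Real.exp_add]; ring_nf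
    calc ε ≤ ((L + 1) * (n : ℝ) ^ L) ^ 2 * (3 * Real.exp (-(η ^ 2 / 4 * ((n : ℝ) - L)))) :=
          mul_le_mul_of_nonneg_right h6 (by positivity)
      _ = _ := by rw [h7, mul_pow, ← pow_mul, mul_comm L 2]; ring
  linarith

/-- Regularity at densities arbitrarily close to the fixed point is attained. -/
lemma exists_burnIn (hβ : ∀ i, 0 < β i) {p : ℝ} (hsub : Subcritical V G β p) {L : ℕ}
    (hV : ∀ i, V i ≤ L) {q r : ℝ} (hq : q < p) (hr : p < r) :
    ∃ a b, q < a ∧ 0 ≤ a ∧ b < r ∧ a ≤ p ∧ p ≤ b ∧ BurnIn V G β L a b := by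
  obtain ⟨hp, huniq, -⟩ := hsub
  have hφ := continuous_phiFn V G β
  have hp0 : 0 < p := hp ▸ Phi_pos _
  have hp1 : p < 1 := hp ▸ Phi_lt_one _
  let f : ℝ → ℝ := fun x => (x + phiFn V G β x) / 2
  have hf : Continuous f := by fun_prop
  have hpos : ∀ x : ℝ, 0 < phiFn V G β x := fun x => Phi_pos _
  have hone : ∀ x : ℝ, phiFn V G β x < 1 := fun x => Phi_lt_one _
  have hlow : ∀ x, 0 ≤ x → x < p → x < phiFn V G β x := by
    intro x hx hxp
    by_contra! hle
    obtain ⟨y, hy, hy'⟩ := intermediate_value_Icc' (f := fun x => phiFn V G β x - x) hx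
      (by fun_prop) (show (0 : ℝ) ∈ Set.Icc _ _ from
        ⟨by linarith, by have := hpos 0; simpa using this.le⟩)
    have := huniq y (by simpa using sub_eq_zero.1 hy')
    linarith [hy.2]
  have hhigh : ∀ x, p < x → phiFn V G β x < x := by
    intro x hxp
    by_contra! hle
    have hx1 : x ≤ 1 := hle.trans (hone x).le
    obtain ⟨y, hy, hy'⟩ := intermediate_value_Icc' (f := fun x => phiFn V G β x - x) hx1
      (by fun_prop) (show (0 : ℝ) ∈ Set.Icc _ _ from
        ⟨by have := hone 1; linarith, by linarith⟩)
    have := huniq y (by simpa using sub_eq_zero.1 hy')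
    linarith [hy.1]
  have hlow' : ∀ x, 0 ≤ x → x < p → phiFn V G β x ≤ p := fun x h0 hx =>
    (phiFn_mono V G hβ h0 hx.le).trans hp.le
  have hhigh' : ∀ x, p < x → p ≤ phiFn V G β x := fun x hx =>
    hp.symm.le.trans (phiFn_mono V G hβ hp0.le hx.le)
  let a : ℕ → ℝ := fun j => f^[j] 0
  let b : ℕ → ℝ := fun j => f^[j] 1
  have has : ∀ j, a (j + 1) = f (a j) := fun j => Function.iterate_succ_apply' f j 0
  have hbs : ∀ j, b (j + 1) = f (b j) := fun j => Function.iterate_succ_apply' f j 1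
  have ha : ∀ j, 0 ≤ a j ∧ a j < p := by
    intro j
    induction j with
    | zero => exact ⟨le_rfl, hp0⟩
    | succ j ih =>
      rw [has]
      have := hlow' _ ih.1 ih.2
      have := hpos (a j)
      constructor <;> simp only [f] <;> linarith
  have hb : ∀ j, p < b j := by
    intro j
    induction j with
    | zero => exact hp1
    | succ j ih =>
      rw [hbs]
      have := hhigh' _ ih
      simp only [f]; linarith
  have hfix : ∀ x, f x = x → x = p := fun x hx => huniq x (by simp only [f] at hx; linarith)
  have hta : Tendsto a atTop (nhds p) := by
    have hmono : Monotone a := monotone_nat_of_le_succ fun j => by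
      rw [has]
      have := hlow _ (ha j).1 (ha j).2
      simp only [f]; linarith
    have hl := tendsto_atTop_ciSup hmono ⟨p, by rintro _ ⟨j, rfl⟩; exact (ha j).2.le⟩
    have h2 := isFixedPt_of_tendsto_iterate hl hf.continuousAt
    rwa [hfix _ h2] at hl
  have htb : Tendsto b atTop (nhds p) := by
    have hmono : Antitone b := antitone_nat_of_succ_le fun j => by
      rw [hbs]
      have := hhigh _ (hb j)
      simp only [f]; linarith
    have hl := tendsto_atTop_ciInf hmono ⟨p, by rintro _ ⟨j, rfl⟩; exact (hb j).le⟩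
    have h2 := isFixedPt_of_tendsto_iterate hl hf.continuousAt
    rwa [hfix _ h2] at hl
  have hburn : ∀ j, BurnIn V G β L (a j) (b j) := by
    intro j
    induction j with
    | zero => exact burnIn_zero_one V G β L
    | succ j ih =>
      refine ih.step hβ hV (ha j).1 (hp0.le.trans (hb j).le) (ha (j + 1)).1 ?_ ?_
      · have := hlow _ (ha j).1 (ha j).2
        rw [has]; simp only [f]; linarith
      · have := hhigh _ (hb j)
        rw [hbs]; simp only [f]; linarith
  obtain ⟨j, hj1, hj2⟩ := ((hta.eventually_const_lt hq).and (htb.eventually_lt_const hr)).exists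
  exact ⟨a j, b j, hj1, (ha j).1, hj2, (ha j).2.le, (hb j).le, hburn j⟩

end Sub

section Contraction

variable {s : ℕ} {V : Fin s → ℕ} {G : ∀ i, SimpleGraph (Fin (V i))} {β : Fin s → ℝ}

lemma exists_contraction (hβ : ∀ i, 0 < β i) {p : ℝ} (hsub : Subcritical V G β p) {L : ℕ}
    (hV : ∀ i, V i ≤ L) : ∃ δ a b : ℝ, 0 < δ ∧ δ < 1 ∧ BurnIn V G β L a b ∧
      ∀ᶠ n : ℕ in atTop, ∀ x y : Config n, x ≤ y → UpperRegular L b y → LowerRegular L a x →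
        ∑ e, (Phi (dHam V G β e y) - Phi (dHam V G β e x))
          ≤ (1 - δ) * ∑ f : EdgeSet n, (ind y f.1 - ind x f.1) := by
  let Φ' : ℝ → ℝ := fun u => Real.exp u / (1 + Real.exp u) ^ 2
  have hΦ' : Continuous Φ' := by
    refine Real.continuous_exp.div (by fun_prop) fun u => ?_
    positivity
  have hΦ'0 : ∀ u, 0 < Φ' u := fun u => by positivity
  have hlt : Φ' (Psi V G β p) * PsiDeriv V G β p < 1 := by
    have h : HasDerivAt (phiFn V G β) (Φ' (Psi V G β p) * PsiDeriv V G β p) p :=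
      (hasDerivAt_Phi _).comp p (hasDerivAt_Psi V G β p)
    exact h.deriv ▸ hsub.2.2
  obtain ⟨κ, hκ1, hκ⟩ : ∃ κ, κ * PsiDeriv V G β p < 1 ∧ Φ' (Psi V G β p) < κ := by
    have h1 : ∀ᶠ κ in nhds (Φ' (Psi V G β p)), κ * PsiDeriv V G β p < 1 :=
      (Continuous.tendsto (by fun_prop) _).eventually_lt_const hlt
    exact ((h1.filter_mono nhdsWithin_le_nhds).and
      (self_mem_nhdsWithin (s := Set.Ioi (Φ' (Psi V G β p))))).exists
  have hκ0 : 0 < κ := (hΦ'0 _).trans hκ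
  obtain ⟨ε, hε, hball⟩ := Metric.eventually_nhds_iff_ball.1
    ((hΦ'.tendsto (Psi V G β p)).eventually_le_const hκ)
  have hlip : ∀ u ∈ Metric.ball (Psi V G β p) ε, ∀ v ∈ Metric.ball (Psi V G β p) ε, u ≤ v →
      Phi v - Phi u ≤ κ * (v - u) := by
    refine Convex.image_sub_le_mul_sub_of_deriv_le (convex_ball _ _)
      continuous_Phi.continuousOn
      (fun u _ => (hasDerivAt_Phi u).differentiableAt.differentiableWithinAt) fun u hu => ?_
    rw [(hasDerivAt_Phi u).deriv]
    exact hball u (interior_subset hu)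
  obtain ⟨δ, hδ0, hδ⟩ : ∃ δ, 0 < δ ∧ δ < min 1 (1 - κ * PsiDeriv V G β p) :=
    exists_between (lt_min one_pos (sub_pos.2 hκ1))
  have hcont : Continuous (PsiDeriv V G β) := by unfold PsiDeriv; fun_prop
  have hnear : ∀ᶠ q in nhds p, κ * PsiDeriv V G β q < 1 - δ ∧
      Psi V G β q ∈ Metric.ball (Psi V G β p) ε := by
    have h1 : Tendsto (fun q => κ * PsiDeriv V G β q) (nhds p)
        (nhds (κ * PsiDeriv V G β p)) := Continuous.tendsto (by fun_prop) _
    refine (h1.eventually_lt_const ?_).and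
      (((continuous_Psi V G β).tendsto p).eventually (Metric.ball_mem_nhds _ hε))
    linarith [hδ.trans_le (min_le_right _ _)]
  obtain ⟨q, r, ⟨hq, hr⟩, hqr⟩ := mem_nhds_iff_exists_Ioo_subset.1 hnear
  obtain ⟨a, b, hqa, ha0, hbr, hap, hpb, hburn⟩ := exists_burnIn hβ hsub hV hq hr
  have hb := hqr ⟨hq.trans_le hpb, hbr⟩
  have ha := hqr ⟨hqa, hap.trans_lt hr⟩
  refine ⟨δ, a, b, hδ0, hδ.trans_le (min_le_left _ _), hburn, ?_⟩
  have hlim : Tendsto (fun n : ℕ => (1 - (L : ℝ) / n) ^ L * Psi V G β a) atTop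
      (nhds (Psi V G β a)) := by
    have h1 : Tendsto (fun n : ℕ => (1 - (L : ℝ) / n) ^ L * Psi V G β a) atTop
        (nhds ((1 - 0) ^ L * Psi V G β a)) :=
      ((tendsto_const_nhds.sub (tendsto_const_div_atTop_nhds_zero_nat (L : ℝ))).pow L).mul_const _
    simpa using h1
  filter_upwards [hlim.eventually (Metric.isOpen_ball.mem_nhds ha.2), eventually_ge_atTop L,
    eventually_gt_atTop 0] with n hn hL hn0 x y hxy hy hx
  have hb0 : 0 ≤ b := ha0.trans (hap.trans hpb)
  have hIcc : ∀ u, (1 - (L : ℝ) / n) ^ L * Psi V G β a ≤ u → u ≤ Psi V G β b →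
      u ∈ Metric.ball (Psi V G β p) ε := by
    have ha2 : (1 - (L : ℝ) / n) ^ L * Psi V G β a ∈ Metric.ball (Psi V G β p) ε := hn
    have hb2 := hb.2
    intro u h1 h2
    rw [Real.ball_eq_Ioo, Set.mem_Ioo] at ha2 hb2 ⊢
    exact ⟨ha2.1.trans_le h1, h2.trans_lt hb2.2⟩
  have hstep : ∀ e, Phi (dHam V G β e y) - Phi (dHam V G β e x)
      ≤ κ * (dHam V G β e y - dHam V G β e x) := by
    intro e
    have h1 := Psi_le_dHam V G hβ hV ha0 x hx e hn0 hL
    have h2 := dHam_le_Psi V G hβ hV hb0 y hy e hn0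
    have h3 := dHam_mono V G hβ e hxy
    exact hlip _ (hIcc _ h1 (h3.trans h2)) _ (hIcc _ (h1.trans h3) h2) h3
  have hd : 0 ≤ ∑ f : EdgeSet n, (ind y f.1 - ind x f.1) :=
    sum_nonneg fun f _ => sub_nonneg.2 (ind_mono hxy f.1)
  calc ∑ e, (Phi (dHam V G β e y) - Phi (dHam V G β e x))
      ≤ κ * ∑ e, (dHam V G β e y - dHam V G β e x) := by
        rw [mul_sum]; exact sum_le_sum fun e _ => hstep e
    _ ≤ κ * (PsiDeriv V G β b * ∑ f : EdgeSet n, (ind y f.1 - ind x f.1)) :=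
        mul_le_mul_of_nonneg_left (sum_dHam_sub_le V G hβ hV hb0 hxy hy hn0) hκ0.le
    _ ≤ _ := by
        rw [← mul_assoc]
        exact mul_le_mul_of_nonneg_right hb.1.le hd

/-- The number of edges of a configuration. -/
noncomputable def edgeCount {n : ℕ} (x : Config n) : ℝ := ∑ f : EdgeSet n, ind x f.1

lemma edgeCount_nonneg {n : ℕ} (x : Config n) : 0 ≤ edgeCount x :=
  sum_nonneg fun _ _ => ind_nonneg _ _

lemma edgeCount_le {n : ℕ} (x : Config n) : edgeCount x ≤ Fintype.card (EdgeSet n) := by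
  refine (sum_le_card_nsmul univ _ 1 fun f _ => ind_le_one x f.1).trans ?_
  rw [nsmul_eq_mul, mul_one, card_univ]

lemma edgeCount_update {n : ℕ} (x : Config n) (e : EdgeSet n) (b : Bool) :
    edgeCount (Function.update x e b) = edgeCount x - ind x e.1 + if b = true then 1 else 0 := by
  have h1 := add_sum_erase univ (fun f : EdgeSet n => ind x f.1) (mem_univ e)
  have h2 := add_sum_erase univ (fun f : EdgeSet n => ind (Function.update x e b) f.1)
    (mem_univ e)
  have h3 : ∑ f ∈ univ.erase e, ind (Function.update x e b) f.1
      = ∑ f ∈ univ.erase e, ind x f.1 := sum_congr rfl fun f hf =>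
    ind_update_of_ne x e b fun h => ne_of_mem_erase hf (Subtype.ext h)
  rw [edgeCount, edgeCount, ← h1, ← h2, h3, ind_update_self]
  ring

lemma glauber_edgeCount {n : ℕ} (hn : 2 ≤ n) (x : Config n) :
    glauber V G β n edgeCount x = edgeCount x + (Fintype.card (EdgeSet n) : ℝ)⁻¹ *
      (∑ e, Phi (dHam V G β e x) - edgeCount x) := by
  have := nonempty_edgeSet hn
  have hM : (Fintype.card (EdgeSet n) : ℝ) ≠ 0 := Nat.cast_ne_zero.2 Fintype.card_ne_zero
  rw [glauber, avg_thStep hn (fun _ _ => (Phi_pos _).le) (fun _ _ => (Phi_lt_one _).le)]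
  have h : ∀ e, Phi (dHam V G β e x) * edgeCount (Function.update x e true)
      + (1 - Phi (dHam V G β e x)) * edgeCount (Function.update x e false)
      = edgeCount x + (Phi (dHam V G β e x) - ind x e.1) := by
    intro e
    rw [edgeCount_update, edgeCount_update, if_pos rfl, if_neg Bool.false_ne_true]
    ring
  rw [sum_congr rfl fun e _ => h e, sum_add_distrib, sum_const, card_univ, nsmul_eq_mul,
    sum_sub_distrib, mul_add, inv_mul_cancel_left₀ hM]
  rfl

lemma thStep_mono {n : ℕ} {τ : EdgeSet n → Config n → ℝ} (hτ : ∀ e, Monotone (τ e))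
    (ω : EdgeSet n × ℝ) {x y : Config n} (h : x ≤ y) : thStep τ ω x ≤ thStep τ ω y := by
  intro e
  by_cases he : e = ω.1
  · subst he
    simp only [thStep, Function.update_self]
    by_cases h1 : ω.2 ≤ τ ω.1 x
    · simp [h1.trans (hτ _ h)]
    · simp [h1]
  · simp only [thStep, Function.update_of_ne he]
    exact h e

/-- The thresholds of the grand coupling. -/
noncomputable def threshold (V : Fin s → ℕ) (G : ∀ i, SimpleGraph (Fin (V i))) (β : Fin s → ℝ)
    {n : ℕ} (e : EdgeSet n) (x : Config n) : ℝ := Phi (dHam V G β e x)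

lemma threshold_mono (hβ : ∀ i, 0 < β i) {n : ℕ} (e : EdgeSet n) :
    Monotone (threshold V G β e) := fun _ _ h => Phi_mono (dHam_mono V G hβ e h)

lemma gcStep_eq {n : ℕ} (ω : EdgeSet n × ℝ) (x : Config n) :
    gcStep V G β ω x = thStep (threshold V G β) ω x := by
  unfold gcStep thStep threshold
  congr 1

lemma gcRun_eq_drive {n : ℕ} (t : ℕ) (ω : Fin t → EdgeSet n × ℝ) (x : Config n) :
    gcRun V G β t ω x = drive (thStep (threshold V G β)) t ω x := by
  induction t with
  | zero => rfl
  | succ t ih => rw [gcRun, gcStep_eq, ih, drive]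

lemma gcRun_mono (hβ : ∀ i, 0 < β i) {n : ℕ} (t : ℕ) (ω : Fin t → EdgeSet n × ℝ)
    {x y : Config n} (h : x ≤ y) : gcRun V G β t ω x ≤ gcRun V G β t ω y := by
  induction t with
  | zero => exact h
  | succ t ih =>
    rw [gcRun, gcRun, gcStep_eq, gcStep_eq]
    exact thStep_mono (threshold_mono hβ) _ (ih _)

lemma drive_jointStep {n : ℕ} {ι : Type*} (τ : ι → EdgeSet n → Config n → ℝ) (t : ℕ)
    (ω : Fin t → EdgeSet n × ℝ) (σ : ι → Config n) (i : ι) :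
    drive (jointStep τ) t ω σ i = drive (thStep (τ i)) t ω (σ i) := by
  induction t with
  | zero => rfl
  | succ t ih => rw [drive, drive, jointStep, ih]

lemma hammingDist_eq {n : ℕ} {x y : Config n} (h : x ≤ y) :
    (hammingDist y x : ℝ) = edgeCount y - edgeCount x := by
  rw [hammingDist, card_filter, edgeCount, edgeCount, ← sum_sub_distrib]
  push_cast
  refine sum_congr rfl fun e _ => ?_
  rw [ind_coe, ind_coe]
  have := h e
  revert this
  cases x e <;> cases y e <;> simp

lemma coupled_step_le {n L : ℕ} (hn : 2 ≤ n) {δ a b : ℝ} (hδ0 : 0 < δ) (hδ1 : δ < 1)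
    (hc : ∀ x y : Config n, x ≤ y → UpperRegular L b y → LowerRegular L a x →
      ∑ e, (Phi (dHam V G β e y) - Phi (dHam V G β e x))
        ≤ (1 - δ) * ∑ f : EdgeSet n, (ind y f.1 - ind x f.1)) {x y : Config n} (hxy : x ≤ y) :
    glauber V G β n edgeCount y - glauber V G β n edgeCount x
      ≤ (1 - δ / Fintype.card (EdgeSet n)) * (edgeCount y - edgeCount x)
        + 2 * (irregular L a b y + irregular L a b x) := by
  have := nonempty_edgeSet hn
  have hM : (0 : ℝ) < Fintype.card (EdgeSet n) := Nat.cast_pos.2 Fintype.card_pos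
  rw [glauber_edgeCount hn, glauber_edgeCount hn]
  have hM' : (0 : ℝ) ≤ (Fintype.card (EdgeSet n) : ℝ)⁻¹ := inv_nonneg.2 hM.le
  have hdM : edgeCount y - edgeCount x ≤ Fintype.card (EdgeSet n) := by
    linarith [edgeCount_le y, edgeCount_nonneg x]
  have hd0 : 0 ≤ edgeCount y - edgeCount x := by
    rw [edgeCount, edgeCount, ← sum_sub_distrib]
    exact sum_nonneg fun f _ => sub_nonneg.2 (ind_mono hxy f.1)
  have hirr : ∀ z : Config n, 0 ≤ irregular L a b z := irregular_nonneg L a b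
  by_cases hreg : UpperRegular L b y ∧ LowerRegular L a x
  · have h1 := hc x y hxy hreg.1 hreg.2
    rw [sum_sub_distrib, sum_sub_distrib] at h1
    have h2 := mul_le_mul_of_nonneg_left h1 hM'
    have h3 : δ / (Fintype.card (EdgeSet n) : ℝ) = (Fintype.card (EdgeSet n) : ℝ)⁻¹ * δ := by
      rw [div_eq_inv_mul]
    rw [h3]
    unfold edgeCount
    have h4 := hirr y
    have h5 := hirr x
    unfold edgeCount at hd0
    nlinarith
  · have h1 : 1 ≤ irregular L a b y + irregular L a b x := by
      by_cases hy : UpperRegular L b y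
      · have : irregular L a b x = 1 := if_neg fun h => hreg ⟨hy, h.2⟩
        linarith [hirr y]
      · have : irregular L a b y = 1 := if_neg fun h => hy h.1
        linarith [hirr x]
    have h2 : ∑ e, Phi (dHam V G β e y) - ∑ e, Phi (dHam V G β e x)
        ≤ Fintype.card (EdgeSet n) := by
      rw [← sum_sub_distrib]
      refine (sum_le_card_nsmul univ _ 1 fun e _ => ?_).trans ?_
      · linarith [Phi_lt_one (dHam V G β e y), Phi_pos (dHam V G β e x)]
      · rw [nsmul_eq_mul, mul_one, card_univ]
    have h3 := mul_le_mul_of_nonneg_left h2 hM'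
    rw [inv_mul_cancel₀ hM.ne'] at h3
    have h4 : δ / Fintype.card (EdgeSet n) * (edgeCount y - edgeCount x) ≤ 1 := by
      rw [div_mul_eq_mul_div, div_le_one hM]
      nlinarith
    have h5 := mul_nonneg hM' hd0
    linarith

/-- The pair of extremal chains. -/
noncomputable def pairOp (V : Fin s → ℕ) (G : ∀ i, SimpleGraph (Fin (V i))) (β : Fin s → ℝ)
    (n : ℕ) : Module.End ℝ ((Bool → Config n) → ℝ) :=
  avg (seed n) (jointStep fun _ => threshold V G β)

/-- The number of disagreements of an ordered pair. -/
noncomputable def gap {n : ℕ} (σ : Bool → Config n) : ℝ :=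
  edgeCount (σ true) - edgeCount (σ false)

/-- The extremal pair of configurations. -/
def extremal (n : ℕ) : Bool → Config n := fun i _ => i

lemma integral_hammingDist_eq (hβ : ∀ i, 0 < β i) {n : ℕ} (hn : 2 ≤ n) (t : ℕ) :
    ∫ ω : Fin t → EdgeSet n × ℝ, (hammingDist (gcRun V G β t ω (fun _ => true))
        (gcRun V G β t ω (fun _ => false)) : ℝ) ∂(seeds n t)
      = (pairOp V G β n ^ t) gap (extremal n) := by
  have := isProbabilityMeasure_seed hn
  rw [pairOp, ← integral_drive (seed n) (measurable_jointStep _)]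
  refine integral_congr_ae (ae_of_all _ fun ω => ?_)
  simp only
  rw [hammingDist_eq (gcRun_mono hβ t ω fun _ => Bool.false_le _), gap, drive_jointStep,
    drive_jointStep, gcRun_eq_drive, gcRun_eq_drive]
  rfl

lemma pairOp_gap_le (hβ : ∀ i, 0 < β i) {n L : ℕ} (hn : 2 ≤ n) {δ a b ε : ℝ} (hδ0 : 0 < δ)
    (hδ1 : δ < 1) (hc : ∀ x y : Config n, x ≤ y → UpperRegular L b y → LowerRegular L a x →
      ∑ e, (Phi (dHam V G β e y) - Phi (dHam V G β e x))
        ≤ (1 - δ) * ∑ f : EdgeSet n, (ind y f.1 - ind x f.1)) {T : ℕ}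
    (hT : ∀ t, T ≤ t → ∀ z : Config n, (glauber V G β n ^ t) (irregular L a b) z ≤ ε) (u : ℕ) :
    (pairOp V G β n ^ (T + u)) gap (extremal n)
      ≤ (1 - δ / Fintype.card (EdgeSet n)) ^ u * Fintype.card (EdgeSet n)
        + 4 * ε * (Fintype.card (EdgeSet n) / δ) := by
  have := isProbabilityMeasure_seed hn
  have := nonempty_edgeSet hn
  have hM : (1 : ℝ) ≤ Fintype.card (EdgeSet n) := by
    exact_mod_cast Nat.one_le_iff_ne_zero.2 (Fintype.card_ne_zero (α := EdgeSet n))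
  set M : ℝ := (Fintype.card (EdgeSet n) : ℝ)
  have hθ : 0 ≤ 1 - δ / M := by
    rw [sub_nonneg, div_le_one (by linarith)]; linarith
  let I : Set (Bool → Config n) := {σ | σ false ≤ σ true}
  have hI : ∀ ω, ∀ σ ∈ I, jointStep (fun _ => threshold V G β) ω σ ∈ I := fun ω σ hσ =>
    thStep_mono (threshold_mono hβ) ω hσ
  have hproj : ∀ (i : Bool) (f : Config n → ℝ) (t : ℕ) (σ : Bool → Config n),
      (pairOp V G β n ^ t) (fun σ => f (σ i)) σ = (glauber V G β n ^ t) f (σ i) :=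
    fun i f t σ => avg_jointStep_pow hn (fun _ => threshold V G β) i f t σ
  let g : (Bool → Config n) → ℝ := (2 : ℝ) • ((fun σ => irregular L a b (σ true))
    + fun σ => irregular L a b (σ false))
  have hstep : ∀ σ ∈ I, pairOp V G β n gap σ ≤ ((1 - δ / M) • gap + g : (Bool → Config n) → ℝ) σ := by
    intro σ hσ
    have h1 : pairOp V G β n gap σ
        = glauber V G β n edgeCount (σ true) - glauber V G β n edgeCount (σ false) := by
      have h2 := hproj true edgeCount 1 σ
      have h3 := hproj false edgeCount 1 σ
      rw [pow_one, pow_one] at h2 h3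
      rw [← h2, ← h3, ← Pi.sub_apply, ← map_sub]
      rfl
    rw [h1]
    exact coupled_step_le hn hδ0 hδ1 hc hσ
  induction u with
  | zero =>
    have h1 := avg_pow_mono (seed n) (jointStep fun _ => threshold V G β)
      (f := gap) (g := fun _ => M) (fun σ => by
        have h2 := edgeCount_le (σ true)
        have h3 := edgeCount_nonneg (σ false)
        simp only [gap, M]
        linarith) T (extremal n)
    rw [avg_pow_const _ (measurable_jointStep _)] at h1
    have hε : 0 ≤ ε := by
      have h2 := avg_pow_mono (seed n) (thStep (threshold V G β)) (f := fun _ => 0)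
        (irregular_nonneg L a b) T (extremal n true)
      rw [avg_pow_const _ (measurable_thStep _)] at h2
      exact h2.trans (hT T le_rfl _)
    have h4 : 0 ≤ 4 * ε * (M / δ) := by positivity
    rw [pow_zero, one_mul, add_zero]
    exact h1.trans (by linarith)
  | succ u ih =>
    have h1 := avg_pow_le_of_invariant (seed n) hI hstep (T + u) (extremal n)
      (fun _ => Bool.false_le _)
    have h2 : (pairOp V G β n ^ (T + u)) ((1 - δ / M) • gap + g) (extremal n)
        = (1 - δ / M) * (pairOp V G β n ^ (T + u)) gap (extremal n)
          + 2 * ((glauber V G β n ^ (T + u)) (irregular L a b) (extremal n true)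
          + (glauber V G β n ^ (T + u)) (irregular L a b) (extremal n false)) := by
      simp only [g, map_add, map_smul, Pi.add_apply, Pi.smul_apply, smul_eq_mul, hproj]
    rw [← add_assoc, pow_succ, Module.End.mul_apply]
    refine h1.trans (h2.le.trans ?_)
    have h3 := hT (T + u) (Nat.le_add_right _ _) (extremal n true)
    have h4 := hT (T + u) (Nat.le_add_right _ _) (extremal n false)
    have h5 := mul_le_mul_of_nonneg_left ih hθ
    have h6 : (1 - δ / M) * ((1 - δ / M) ^ u * M + 4 * ε * (M / δ))
        = (1 - δ / M) ^ (u + 1) * M + 4 * ε * (M / δ) - 4 * ε := by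
      have hM0 : M ≠ 0 := by linarith
      have h7 : δ / M * (M / δ) = 1 := by field_simp
      linear_combination (-4 * ε) * h7
    linarith

lemma measurable_gcRun {n : ℕ} (t : ℕ) (x : Config n) :
    Measurable fun ω : Fin t → EdgeSet n × ℝ => gcRun V G β t ω x := by
  simp only [gcRun_eq_drive]
  exact measurable_drive (measurable_thStep _) t x

lemma measureReal_ne_le {Ω : Type*} [MeasurableSpace Ω] (P : Measure Ω) [IsFiniteMeasure P]
    {ι : Type*} [Fintype ι] {X Y : Ω → ι → Bool} (hX : Measurable X) (hY : Measurable Y) :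
    P.real {ω | X ω ≠ Y ω} ≤ ∫ ω, (hammingDist (X ω) (Y ω) : ℝ) ∂P := by
  classical
  have hN : MeasurableSet {ω | X ω ≠ Y ω} := (measurableSet_eq_fun hX hY).compl
  have hint := integrable_comp_of_fintype P
    (fun q : (ι → Bool) × (ι → Bool) => (hammingDist q.1 q.2 : ℝ)) (X := fun ω => (X ω, Y ω))
    (hX.prodMk hY)
  rw [← integral_indicator_one hN]
  refine integral_mono ((integrable_const (1 : ℝ)).indicator hN) hint fun ω => ?_
  by_cases h : X ω = Y ω
  · rw [Set.indicator_of_notMem (by simpa using h)]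
    exact Nat.cast_nonneg _
  · rw [Set.indicator_of_mem h, Pi.one_apply]
    exact Nat.one_le_cast.2 (hammingDist_pos.2 h)

lemma dTVmeas_lawAt_le (hβ : ∀ i, 0 < β i) {n : ℕ} (hn : 2 ≤ n) (t : ℕ)
    (μ ν : Measure (Config n)) [IsProbabilityMeasure μ] [IsProbabilityMeasure ν] :
    dTVmeas (lawAt V G β t μ) (lawAt V G β t ν)
      ≤ ∫ ω : Fin t → EdgeSet n × ℝ, (hammingDist (gcRun V G β t ω (fun _ => true))
        (gcRun V G β t ω (fun _ => false)) : ℝ) ∂(seeds n t) := by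
  have := isProbabilityMeasure_seed hn
  have hS : IsProbabilityMeasure (seeds n t) := by unfold seeds; infer_instance
  set X : (Fin t → EdgeSet n × ℝ) → Config n := fun ω => gcRun V G β t ω (fun _ => true)
  set Y : (Fin t → EdgeSet n × ℝ) → Config n := fun ω => gcRun V G β t ω (fun _ => false)
  have hX : Measurable X := measurable_gcRun t _
  have hY : Measurable Y := measurable_gcRun t _
  have hrun : Measurable fun q : Config n × (Fin t → EdgeSet n × ℝ) => gcRun V G β t q.2 q.1 :=
    measurable_from_prod_countable_right fun x => measurable_gcRun t x
  have heq : ∀ ω x, X ω = Y ω → gcRun V G β t ω x = X ω := fun ω x h =>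
    le_antisymm (gcRun_mono hβ t ω fun e => Bool.le_true _)
      (h.le.trans (gcRun_mono hβ t ω fun e => Bool.false_le _))
  have hbound := measureReal_ne_le (seeds n t) hX hY
  have hlaw : ∀ (ρ : Measure (Config n)) [IsProbabilityMeasure ρ] (A : Set (Config n)),
      (seeds n t).real {ω | X ω ∈ A ∧ X ω = Y ω} ≤ (lawAt V G β t ρ A).toReal ∧
      (lawAt V G β t ρ A).toReal ≤ (seeds n t).real {ω | X ω ∈ A ∧ X ω = Y ω}
        + (seeds n t).real {ω | X ω ≠ Y ω} := by
    intro ρ _ A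
    have h1 : ∀ B : Set (Fin t → EdgeSet n × ℝ),
        (ρ.prod (seeds n t)).real (Set.univ ×ˢ B) = (seeds n t).real B := by
      intro B
      rw [measureReal_prod_prod]
      simp
    have h2 : (lawAt V G β t ρ A).toReal = (ρ.prod (seeds n t)).real
        ((fun q : Config n × (Fin t → EdgeSet n × ℝ) => gcRun V G β t q.2 q.1) ⁻¹' A) := by
      rw [lawAt, Measure.map_apply hrun (Set.toFinite A).measurableSet]
      rfl
    rw [h2, ← h1, ← h1]
    constructor
    · refine measureReal_mono fun q hq => ?_
      rw [Set.mem_preimage, heq _ _ hq.2.2]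
      exact hq.2.1
    · refine le_trans (measureReal_mono fun q hq => ?_) (measureReal_union_le _ _)
      by_cases h : X q.2 = Y q.2
      · rw [Set.mem_preimage, heq _ _ h] at hq
        exact Or.inl ⟨trivial, hq, h⟩
      · exact Or.inr ⟨trivial, h⟩
  refine (ciSup_le fun A => ?_).trans hbound
  have h1 := hlaw μ A
  have h2 := hlaw ν A
  rw [abs_sub_le_iff]
  exact ⟨by linarith, by linarith⟩

end Contraction

/-- **(Equations (235), (237): contraction after the burn-in time `c n²`).**
If `β` is sub-critical, there are `c, δ, α > 0` such that for all large `n` and all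
`t ≥ c n²`, `𝔼[d_H(Z^+(t), Z^-(t))] ≤ (1 - δ/M)^{t - c n²} M + e^{-α n}` under the
grand coupling, and consequently for any two initial distributions `μ, ν`,
`d_TV(μ_t, ν_t) ≤ (1 - δ/M)^{t - c n²} M + e^{-α n}`. -/
theorem burnin_contraction {s : ℕ} (V : Fin s → ℕ)
    (G : ∀ i, SimpleGraph (Fin (V i))) (β : Fin s → ℝ) (hβ : ∀ i, 0 < β i)
    (p : ℝ) (hsub : Subcritical V G β p) :
    ∃ c δ alp : ℝ, 0 < c ∧ 0 < δ ∧ 0 < alp ∧ ∃ N : ℕ, ∀ n : ℕ, N ≤ n →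
      ∀ t : ℕ, c * (n : ℝ) ^ 2 ≤ (t : ℝ) →
        ((∫ ω : Fin t → EdgeSet n × ℝ,
            (hammingDist (gcRun V G β t ω (fun _ => true))
              (gcRun V G β t ω (fun _ => false)) : ℝ) ∂(seeds n t)) ≤
          (1 - δ / (Fintype.card (EdgeSet n) : ℝ)) ^ ((t : ℝ) - c * (n : ℝ) ^ 2) *
              (Fintype.card (EdgeSet n) : ℝ) +
            Real.exp (-alp * (n : ℝ))) ∧
        ∀ μ ν : Measure (Config n), IsProbabilityMeasure μ → IsProbabilityMeasure ν →
          dTVmeas (lawAt V G β t μ) (lawAt V G β t ν) ≤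
            (1 - δ / (Fintype.card (EdgeSet n) : ℝ)) ^ ((t : ℝ) - c * (n : ℝ) ^ 2) *
                (Fintype.card (EdgeSet n) : ℝ) +
              Real.exp (-alp * (n : ℝ)) := by
  have hV : ∀ i, V i ≤ ∑ i, V i := fun i =>
    single_le_sum (f := V) (fun _ _ => Nat.zero_le _) (mem_univ i)
  obtain ⟨δ, a, b, hδ0, hδ1, ⟨C, α, hα, hburn⟩, hcontr⟩ := exists_contraction hβ hsub hV
  refine ⟨((C + 1 : ℕ) : ℝ), δ, α / 2, by positivity, hδ0, half_pos hα, ?_⟩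
  obtain ⟨N, hN⟩ := eventually_atTop.1 (hburn.and (hcontr.and ((eventually_ge_atTop 2).and
    (eventually_mul_pow_mul_exp_le (4 / δ) 2 (half_lt_self hα) one_pos))))
  refine ⟨N, fun n hn t ht => ?_⟩
  obtain ⟨hb, hc, hn2, hexp⟩ := hN n hn
  have ht' : (C + 1) * n ^ 2 ≤ t := by exact_mod_cast ht
  obtain ⟨u, rfl⟩ := Nat.exists_eq_add_of_le ht'
  have hu : (((C + 1) * n ^ 2 + u : ℕ) : ℝ) - ((C + 1 : ℕ) : ℝ) * (n : ℝ) ^ 2 = (u : ℝ) := by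
    push_cast
    ring
  rw [hu, Real.rpow_natCast]
  have hcard : (Fintype.card (EdgeSet n) : ℝ) ≤ (n : ℝ) ^ 2 := by
    nlinarith [two_mul_card_edgeSet n, Nat.cast_nonneg (α := ℝ) n]
  have herr : 4 * Real.exp (-α * n) * (Fintype.card (EdgeSet n) / δ)
      ≤ Real.exp (-(α / 2) * n) := by
    rw [one_mul] at hexp
    refine le_trans ?_ hexp
    calc 4 * Real.exp (-α * n) * (Fintype.card (EdgeSet n) / δ)
        = 4 / δ * Fintype.card (EdgeSet n) * Real.exp (-α * n) := by ring
      _ ≤ 4 / δ * (n : ℝ) ^ 2 * Real.exp (-α * n) := by gcongr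
  have hT : ∀ t, (C + 1) * n ^ 2 ≤ t → ∀ z : Config n,
      (glauber V G β n ^ t) (irregular (∑ i, V i) a b) z ≤ Real.exp (-α * n) := fun t ht =>
    hb t (le_trans (Nat.mul_le_mul_right _ C.le_succ) ht)
  have hexpect := (integral_hammingDist_eq (V := V) (G := G) hβ hn2 ((C + 1) * n ^ 2 + u)).le.trans
    ((pairOp_gap_le hβ hn2 hδ0 hδ1 hc hT u).trans (add_le_add_right herr _))
  exact ⟨hexpect, fun μ ν _ _ => (dTVmeas_lawAt_le hβ hn2 _ μ ν).trans hexpect⟩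

end ERGM
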